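/- arXiv:1610.01462 — 3 statements merged into one kernel-verified Lean document; each statement's English description precedes it below -/
import Mathlib

section
/- For every real number t > 0, Q(t) > 0. -/
/-- The function
`Q(t) = (∫₀¹ cos(t log s)(1−s)^{1/2} ds)(2t + 3 tanh(πt/2))
      + (∫₀¹ sin(t log s)(1−s)^{1/2} ds)(3 − 2t tanh(πt/2))`. -/
noncomputable def Q (t : ℝ) : ℝ :=
  (∫ s in (0:ℝ)..1, Real.cos (t * Real.log s) * Real.sqrt (1 - s)) *
    (2 * t + 3 * Real.tanh (Real.pi * t / 2)) +
  (∫ s in (0:ℝ)..1, Real.sin (t * Real.log s) * Real.sqrt (1 - s)) *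
    (3 - 2 * t * Real.tanh (Real.pi * t / 2))

open Complex in
lemma aux_polar (x τ : ℝ) (hx : 0 < x) :
    ∃ r : ℝ, 0 < r ∧ (x : ℂ) + τ * I = r * exp (Real.arctan (τ / x) * I) := by
  have hc := Real.cos_arctan_pos (τ / x)
  refine ⟨x / Real.cos (Real.arctan (τ / x)), by positivity, ?_⟩
  have ht := Real.tan_arctan (τ / x)
  rw [Real.tan_eq_sin_div_cos] at ht
  have hs : Real.sin (Real.arctan (τ / x)) = τ / x * Real.cos (Real.arctan (τ / x)) := by
    rwa [div_eq_iff hc.ne'] at ht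
  rw [exp_mul_I, ← ofReal_cos, ← ofReal_sin, hs]
  have hc' : ((Real.cos (Real.arctan (τ / x)) : ℝ) : ℂ) ≠ 0 := by exact_mod_cast hc.ne'
  have hx' : (x : ℂ) ≠ 0 := by exact_mod_cast hx.ne'
  push_cast at hc' ⊢
  field_simp

lemma aux_sub (x τ : ℝ) (hx : 0 < x) (hτ : 0 < τ) :
    Real.arctan (τ / x) - Real.arctan (τ / (x + 1/4)) =
      Real.arctan ((τ / 4) / (x * (x + 1/4) + τ ^ 2)) := by
  have h := Real.arctan_add (x := τ / (x + 1/4))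
    (y := (τ / 4) / (x * (x + 1/4) + τ ^ 2)) (by
      rw [div_mul_div_comm, div_lt_one (by positivity)]
      nlinarith [mul_pos hx hτ, mul_pos hx hx, mul_pos hτ hτ, mul_pos (mul_pos hx hτ) hτ,
        mul_pos (mul_pos hx hx) hx])
  have e : (τ / (x + 1/4) + (τ / 4) / (x * (x + 1/4) + τ ^ 2)) /
      (1 - τ / (x + 1/4) * ((τ / 4) / (x * (x + 1/4) + τ ^ 2))) = τ / x := by
    have h1 : x + 1/4 ≠ 0 := by positivity
    have h2 : x * (x + 1/4) + τ ^ 2 ≠ 0 := by positivity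
    have e1 : (1 - τ / (x + 1/4) * ((τ / 4) / (x * (x + 1/4) + τ ^ 2))) =
       x * ((x + 1/4)^2 + τ^2) / ((x + 1/4) * (x * (x + 1/4) + τ ^ 2)) := by
      rw [div_mul_div_comm, eq_div_iff (by positivity), sub_mul, div_mul_cancel₀ _ (by positivity)]
      ring
    have e2 : (τ / (x + 1/4) + (τ / 4) / (x * (x + 1/4) + τ ^ 2)) =
       τ * ((x + 1/4)^2 + τ^2) / ((x + 1/4) * (x * (x + 1/4) + τ ^ 2)) := by
      rw [div_add_div _ _ h1 h2]
      congr 1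
      ring
    rw [e1, e2, div_div_div_cancel_right₀ (by positivity), mul_div_mul_right _ _ (by positivity)]
  rw [e] at h
  linarith

/-- phase increment -/
noncomputable def auxPsi (τ : ℝ) (j : ℕ) : ℝ :=
  Real.arctan (τ / (1/4 + j)) - Real.arctan (τ / (1/2 + j))
    + Real.arctan (τ / (5/4 + j)) - Real.arctan (τ / (1 + j))

lemma auxPsi_pos (τ : ℝ) (hτ : 0 < τ) (j : ℕ) : 0 < auxPsi τ j := by
  have h1 := aux_sub (1/4 + j) τ (by positivity) hτ
  have h2 := aux_sub (1 + j) τ (by positivity) hτ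
  rw [show (1/4 + (j:ℝ)) + 1/4 = 1/2 + j by ring] at h1
  rw [show (1 + (j:ℝ)) + 1/4 = 5/4 + j by ring] at h2
  have : Real.arctan ((τ / 4) / ((1 + j) * (5/4 + j) + τ ^ 2)) <
      Real.arctan ((τ / 4) / ((1/4 + j) * (1/2 + j) + τ ^ 2)) := by
    apply Real.arctan_strictMono
    apply div_lt_div_of_pos_left (by positivity) (by positivity)
    have : (0:ℝ) ≤ j := by positivity
    nlinarith
  unfold auxPsi
  linarith

lemma auxPsi_le (τ : ℝ) (hτ : 0 < τ) (j : ℕ) :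
    auxPsi τ j ≤ Real.arctan (τ / (1/4 + j)) - Real.arctan (τ / (1/4 + (j + 1 : ℕ))) := by
  have h1 : Real.arctan (τ / (5/4 + j)) ≤ Real.arctan (τ / (1/2 + j)) :=
    Real.arctan_mono (div_le_div_of_nonneg_left hτ.le (by positivity) (by linarith))
  have h2 : Real.arctan (τ / (5/4 + j)) ≤ Real.arctan (τ / (1 + j)) :=
    Real.arctan_mono (div_le_div_of_nonneg_left hτ.le (by positivity) (by linarith))
  have h3 : (1/4 + ((j + 1 : ℕ) : ℝ)) = 5/4 + j := by push_cast; ring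
  rw [h3]
  unfold auxPsi
  linarith

lemma aux_theta_bounds (τ : ℝ) (hτ : 0 < τ) (n : ℕ) :
    auxPsi τ 0 ≤ ∑ j ∈ Finset.range (n + 1), auxPsi τ j ∧
    ∑ j ∈ Finset.range (n + 1), auxPsi τ j ≤ Real.pi / 2 := by
  constructor
  · exact Finset.single_le_sum (f := auxPsi τ) (fun j _ => (auxPsi_pos τ hτ j).le) (by simp)
  · have h := Finset.sum_le_sum (s := Finset.range (n + 1)) (fun j _ => auxPsi_le τ hτ j)
    rw [Finset.sum_range_sub' (fun j : ℕ => Real.arctan (τ / (1/4 + j)))] at h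
    have h1 := Real.arctan_lt_pi_div_two (τ / (1/4 + (0:ℕ)))
    have h2 : 0 ≤ Real.arctan (τ / (1/4 + (n + 1 : ℕ))) := by
      rw [Real.arctan_nonneg]; positivity
    linarith

/-- partial product -/
noncomputable def auxP (u : ℂ) (n : ℕ) : ℂ :=
  ∏ j ∈ Finset.range n, ((1/4 + u + j) * (5/4 + u + j) / ((1/2 + u + j) * (1 + u + j)))

open Complex in
lemma auxP_polar (τ : ℝ) (n : ℕ) :
    ∃ r : ℝ, 0 < r ∧ auxP (τ * I) n =
      r * exp (((∑ j ∈ Finset.range n, auxPsi τ j : ℝ) : ℂ) * I) := by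
  induction n with
  | zero => exact ⟨1, one_pos, by simp [auxP]⟩
  | succ n ih =>
    obtain ⟨r, hr, h⟩ := ih
    obtain ⟨a, ha, h1⟩ := aux_polar (1/4 + n) τ (by positivity)
    obtain ⟨b, hb, h2⟩ := aux_polar (5/4 + n) τ (by positivity)
    obtain ⟨c, hc, h3⟩ := aux_polar (1/2 + n) τ (by positivity)
    obtain ⟨d, hd, h4⟩ := aux_polar (1 + n) τ (by positivity)
    refine ⟨r * (a * b / (c * d)), by positivity, ?_⟩
    rw [auxP, Finset.prod_range_succ, ← auxP, h, Finset.sum_range_succ]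
    have e1 : (1/4 + τ * I + n : ℂ) = ((1/4 + n : ℝ) : ℂ) + τ * I := by push_cast; ring
    have e2 : (5/4 + τ * I + n : ℂ) = ((5/4 + n : ℝ) : ℂ) + τ * I := by push_cast; ring
    have e3 : (1/2 + τ * I + n : ℂ) = ((1/2 + n : ℝ) : ℂ) + τ * I := by push_cast; ring
    have e4 : (1 + τ * I + n : ℂ) = ((1 + n : ℝ) : ℂ) + τ * I := by push_cast; ring
    rw [e1, e2, e3, e4, h1, h2, h3, h4, auxPsi]
    have hc' : (c : ℂ) ≠ 0 := by exact_mod_cast hc.ne'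
    have hd' : (d : ℂ) ≠ 0 := by exact_mod_cast hd.ne'
    rw [ofReal_add, add_mul, exp_add, ofReal_sub, ofReal_add, ofReal_sub, sub_mul, add_mul, sub_mul,
      exp_sub, exp_add, exp_sub]
    push_cast
    field_simp

open Complex in
lemma aux_G_im (τ : ℝ) (hτ : 0 < τ) :
    0 < (Gamma (1/2 + τ * I) * Gamma (1 + τ * I) /
      (Gamma (1/4 + τ * I) * Gamma (5/4 + τ * I))).im := by
  set u : ℂ := τ * I with hu
  have hne : ∀ x : ℝ, 0 < x → Gamma (x + u) ≠ 0 := fun x hx =>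
    Gamma_ne_zero_of_re_pos (by simp [hu, hx])
  have g1 : Gamma (1/2 + u) ≠ 0 := by simpa using hne (1/2) (by norm_num)
  have g2 : Gamma (1 + u) ≠ 0 := by simpa using hne 1 (by norm_num)
  have g3 : Gamma (1/4 + u) ≠ 0 := by simpa using hne (1/4) (by norm_num)
  have g4 : Gamma (5/4 + u) ≠ 0 := by simpa using hne (5/4) (by norm_num)
  set G := Gamma (1/2 + u) * Gamma (1 + u) / (Gamma (1/4 + u) * Gamma (5/4 + u)) with hG
  have hG0 : G ≠ 0 := div_ne_zero (mul_ne_zero g1 g2) (mul_ne_zero g3 g4)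
  have hlim : Filter.Tendsto (fun n : ℕ => auxP u (n + 1)) Filter.atTop (nhds G) := by
    have := ((GammaSeq_tendsto_Gamma (1/2 + u)).mul (GammaSeq_tendsto_Gamma (1 + u))).div
      ((GammaSeq_tendsto_Gamma (1/4 + u)).mul (GammaSeq_tendsto_Gamma (5/4 + u)))
      (mul_ne_zero g3 g4)
    refine this.congr' ?_
    filter_upwards [Filter.eventually_gt_atTop 0] with n hn
    have hn' : (n : ℂ) ≠ 0 := by exact_mod_cast hn.ne'
    have hf : (Nat.factorial n : ℂ) ≠ 0 := by exact_mod_cast n.factorial_ne_zero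
    have hp : (n : ℂ) ^ (1/2 + u) * (n : ℂ) ^ (1 + u) =
        (n : ℂ) ^ (1/4 + u) * (n : ℂ) ^ (5/4 + u) := by
      rw [← cpow_add _ _ hn', ← cpow_add _ _ hn']; congr 1; ring
    have q3 : (n : ℂ) ^ (1/4 + u) ≠ 0 := by simp [cpow_eq_zero_iff, hn']
    have q4 : (n : ℂ) ^ (5/4 + u) ≠ 0 := by simp [cpow_eq_zero_iff, hn']
    have pne : ∀ x : ℝ, 0 < x → ∏ j ∈ Finset.range (n + 1), ((x : ℂ) + u + j) ≠ 0 := by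
      intro x hx
      rw [Finset.prod_ne_zero_iff]
      intro j _ h0
      have := congrArg re h0
      simp [hu] at this
      have : (0:ℝ) ≤ j := by positivity
      linarith
    have p1 : ∏ j ∈ Finset.range (n + 1), (1/2 + u + j) ≠ 0 := by
      simpa using pne (1/2) (by norm_num)
    have p2 : ∏ j ∈ Finset.range (n + 1), (1 + u + j) ≠ 0 := by
      simpa using pne 1 (by norm_num)
    have p3 : ∏ j ∈ Finset.range (n + 1), (1/4 + u + j) ≠ 0 := by
      simpa using pne (1/4) (by norm_num)
    have p4 : ∏ j ∈ Finset.range (n + 1), (5/4 + u + j) ≠ 0 := by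
      simpa using pne (5/4) (by norm_num)
    simp only [Pi.div_apply, GammaSeq, auxP, Finset.prod_div_distrib, Finset.prod_mul_distrib]
    generalize ∏ j ∈ Finset.range (n + 1), (1/2 + u + (j:ℂ)) = A1 at *
    generalize ∏ j ∈ Finset.range (n + 1), (1 + u + (j:ℂ)) = A2 at *
    generalize ∏ j ∈ Finset.range (n + 1), (1/4 + u + (j:ℂ)) = A3 at *
    generalize ∏ j ∈ Finset.range (n + 1), (5/4 + u + (j:ℂ)) = A4 at *
    generalize (n : ℂ) ^ (1/2 + u) = B1 at *
    generalize (n : ℂ) ^ (1 + u) = B2 at *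
    generalize (n : ℂ) ^ (1/4 + u) = B3 at *
    generalize (n : ℂ) ^ (5/4 + u) = B4 at *
    generalize (Nat.factorial n : ℂ) = K at *
    rw [div_mul_div_comm, div_mul_div_comm, div_div_div_eq, div_eq_div_iff
      (by simp [*]) (by simp [*])]
    linear_combination (K * K * A3 * A4 * A1 * A2) * hp
  have hψ := auxPsi_pos τ hτ 0
  have hψ2 := aux_theta_bounds τ hτ 0
  have hsin : 0 < Real.sin (auxPsi τ 0) :=
    Real.sin_pos_of_pos_of_lt_pi hψ (by linarith [Real.pi_pos, hψ2.1, hψ2.2])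
  have hbd : ∀ n : ℕ, ‖auxP u (n + 1)‖ * Real.sin (auxPsi τ 0) ≤ (auxP u (n + 1)).im := by
    intro n
    obtain ⟨r, hr, h⟩ := auxP_polar τ (n + 1)
    obtain ⟨b1, b2⟩ := aux_theta_bounds τ hτ n
    rw [← hu] at h
    rw [h, norm_mul, norm_exp_ofReal_mul_I, norm_real, Real.norm_of_nonneg hr.le, mul_one,
      im_ofReal_mul, exp_ofReal_mul_I_im]
    gcongr
    exact Real.sin_le_sin_of_le_of_le_pi_div_two (by linarith [Real.pi_pos]) b2 b1
  have hle := le_of_tendsto_of_tendsto' (hlim.norm.mul_const (Real.sin (auxPsi τ 0)))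
    ((continuous_im.tendsto G).comp hlim) hbd
  have : 0 < ‖G‖ * Real.sin (auxPsi τ 0) := mul_pos (norm_pos_iff.mpr hG0) hsin
  linarith

open Complex in
lemma aux_beta (t : ℝ) :
    betaIntegral (1 + t * I) (3/2) =
    ((∫ s in (0:ℝ)..1, Real.cos (t * Real.log s) * Real.sqrt (1 - s) : ℝ) : ℂ) +
    ((∫ s in (0:ℝ)..1, Real.sin (t * Real.log s) * Real.sqrt (1 - s) : ℝ) : ℂ) * I := by
  have hconv := betaIntegral_convergent (u := 1 + t * I) (v := 3/2) (by simp) (by norm_num)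
  have hpt : ∀ s ∈ Set.Ioo (0:ℝ) 1, (s : ℂ) ^ ((1 + t * I : ℂ) - 1) * (1 - (s : ℂ)) ^ ((3/2 : ℂ) - 1) =
      ((Real.cos (t * Real.log s) * Real.sqrt (1 - s) : ℝ) : ℂ) +
      ((Real.sin (t * Real.log s) * Real.sqrt (1 - s) : ℝ) : ℂ) * I := by
    intro s hs
    have h1 : (s : ℂ) ^ ((1 + t * I : ℂ) - 1) =
        Real.cos (t * Real.log s) + Real.sin (t * Real.log s) * I := by
      rw [cpow_def_of_ne_zero (by exact_mod_cast hs.1.ne'), ← ofReal_log hs.1.le,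
        ofReal_cos, ofReal_sin, ← exp_mul_I]
      congr 1
      push_cast
      ring
    have h2 : (1 - (s : ℂ)) ^ ((3/2 : ℂ) - 1) = (Real.sqrt (1 - s) : ℝ) := by
      rw [Real.sqrt_eq_rpow, ofReal_cpow (by linarith [hs.2])]
      push_cast
      norm_num
    rw [h1, h2]
    push_cast
    ring
  have hae : ∀ᵐ s : ℝ, s ∈ Set.uIoc (0:ℝ) 1 →
      (s : ℂ) ^ ((1 + t * I : ℂ) - 1) * (1 - (s : ℂ)) ^ ((3/2 : ℂ) - 1) =
      ((Real.cos (t * Real.log s) * Real.sqrt (1 - s) : ℝ) : ℂ) +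
      ((Real.sin (t * Real.log s) * Real.sqrt (1 - s) : ℝ) : ℂ) * I := by
    filter_upwards [MeasureTheory.Measure.ae_ne MeasureTheory.volume (1:ℝ)] with s hs1 hs
    rw [Set.uIoc_of_le zero_le_one] at hs
    exact hpt s ⟨hs.1, lt_of_le_of_ne hs.2 hs1⟩
  apply Complex.ext
  · have h := reCLM.intervalIntegral_comp_comm hconv
    rw [betaIntegral]
    simp only [add_re, ofReal_re, re_ofReal_mul, I_re, mul_zero, add_zero]
    rw [← reCLM_apply, ← h]
    apply intervalIntegral.integral_congr_ae
    filter_upwards [hae] with s hs hs'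
    rw [hs hs']
    simp only [reCLM_apply, add_re, ofReal_re, re_ofReal_mul, I_re, mul_zero, add_zero]
  · have h := imCLM.intervalIntegral_comp_comm hconv
    rw [betaIntegral]
    simp only [add_im, ofReal_im, im_ofReal_mul, I_im, mul_one, zero_add]
    rw [← imCLM_apply, ← h]
    apply intervalIntegral.integral_congr_ae
    filter_upwards [hae] with s hs hs'
    rw [hs hs']
    simp only [imCLM_apply, add_im, ofReal_im, im_ofReal_mul, I_im, mul_one, zero_add]

open Complex in
lemma aux_main (t : ℝ) : ∃ c : ℝ, 0 < c ∧
    (3 + 2 * t * I) * betaIntegral (1 + t * I) (3/2) *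
      (Real.cosh (Real.pi * t / 2) + Real.sinh (Real.pi * t / 2) * I) =
    c * (Gamma (1/2 + (t/2 : ℝ) * I) * Gamma (1 + (t/2 : ℝ) * I) /
      (Gamma (1/4 + (t/2 : ℝ) * I) * Gamma (5/4 + (t/2 : ℝ) * I))) := by
  set u : ℂ := (t/2 : ℝ) * I with hu
  have htu : (t : ℂ) * I = 2 * u := by rw [hu]; push_cast; ring
  have hne : ∀ x : ℝ, 0 < x → Gamma (x + u) ≠ 0 := fun x hx =>
    Gamma_ne_zero_of_re_pos (by simp [hu, hx])
  have g3 : Gamma (1/4 + u) ≠ 0 := by simpa using hne (1/4) (by norm_num)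
  have g4 : Gamma (5/4 + u) ≠ 0 := by simpa using hne (5/4) (by norm_num)
  have g5 : Gamma (3/4 + u) ≠ 0 := by simpa using hne (3/4) (by norm_num)
  have g6 : Gamma (3/2 + 2 * u) ≠ 0 := Gamma_ne_zero_of_re_pos (by simp [hu])
  have hw : (3/2 + 2 * u) ≠ 0 := by
    intro h
    have := congrArg re h
    simp [hu] at this
  have d1 := Gamma_mul_Gamma_add_half (1/2 + u)
  have d2 := Gamma_mul_Gamma_add_half (3/4 + u)
  rw [show (1/2 + u + 1/2 : ℂ) = 1 + u by ring, show (2 * (1/2 + u) : ℂ) = 1 + 2 * u by ring,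
    show (1 - (1 + 2 * u) : ℂ) = - (2 * u) by ring] at d1
  rw [show (3/4 + u + 1/2 : ℂ) = 5/4 + u by ring, show (2 * (3/4 + u) : ℂ) = 3/2 + 2 * u by ring,
    show (1 - (3/2 + 2 * u) : ℂ) = -(1/2) + - (2 * u) by ring, cpow_add _ _ two_ne_zero] at d2
  have hk : (2 : ℂ) ^ (-(1/2) : ℂ) = ((2:ℝ) ^ (-(1/2) : ℝ) : ℝ) := by
    rw [ofReal_cpow (by norm_num)]; push_cast; rfl
  rw [hk] at d2
  have hk0 : (0:ℝ) < (2:ℝ) ^ (-(1/2) : ℝ) := by positivity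
  set k : ℝ := (2:ℝ) ^ (-(1/2) : ℝ)
  have hE : (2 : ℂ) ^ (-(2 * u)) ≠ 0 := by simp [cpow_eq_zero_iff]
  have hπ : ((Real.sqrt Real.pi : ℝ) : ℂ) ≠ 0 := by
    exact_mod_cast (Real.sqrt_pos.mpr Real.pi_pos).ne'
  have hb := Gamma_mul_Gamma_eq_betaIntegral (s := 1 + 2 * u) (t := 3/2) (by simp [hu]) (by norm_num)
  rw [show (1 + 2 * u + 3/2 : ℂ) = (3/2 + 2 * u) + 1 by ring, Gamma_add_one _ hw] at hb
  have h32 : Gamma (3/2) = ((Real.Gamma (3/2) : ℝ) : ℂ) := by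
    rw [← Gamma_ofReal]; push_cast; rfl
  have h32p : 0 < Real.Gamma (3/2) := Real.Gamma_pos_of_pos (by norm_num)
  rw [h32] at hb
  have hr := Gamma_mul_Gamma_one_sub (1/4 + u)
  have hcj : Gamma (1 - (1/4 + u)) = (starRingEnd ℂ) (Gamma (3/4 + u)) := by
    rw [← Gamma_conj]
    congr 1
    rw [hu]
    simp only [map_add, map_mul, conj_I, conj_ofReal, map_div₀, map_ofNat]
    ring
  have hsin : sin (Real.pi * (1/4 + u)) = (Real.sqrt 2 / 2 : ℝ) *
      (Real.cosh (Real.pi * t / 2) + Real.sinh (Real.pi * t / 2) * I) := by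
    rw [show (Real.pi : ℂ) * (1/4 + u) = ((Real.pi / 4 : ℝ) : ℂ) + ((Real.pi * t / 2 : ℝ) : ℂ) * I by
      rw [hu]; push_cast; ring]
    rw [sin_add_mul_I, ← ofReal_sin, ← ofReal_cos, Real.sin_pi_div_four, Real.cos_pi_div_four,
      ← ofReal_cosh, ← ofReal_sinh]
    ring
  set H : ℂ := (Real.cosh (Real.pi * t / 2) + Real.sinh (Real.pi * t / 2) * I) with hH
  have hH0 : H ≠ 0 := by
    intro h
    have := congrArg re h
    simp only [hH, add_re, ofReal_re, re_ofReal_mul, I_re, mul_zero, add_zero, zero_re] at this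
    exact (Real.cosh_pos _).ne' this
  rw [hsin, hcj] at hr
  have hN : (starRingEnd ℂ) (Gamma (3/4 + u)) * Gamma (3/4 + u) = ((normSq (Gamma (3/4 + u)) : ℝ) : ℂ) := by
    rw [mul_comm, mul_conj]
  have hNp : 0 < normSq (Gamma (3/4 + u)) := normSq_pos.mpr g5
  set N : ℝ := normSq (Gamma (3/4 + u))
  have h2p : 0 < Real.sqrt 2 / 2 := by positivity
  set m : ℝ := Real.sqrt 2 / 2
  refine ⟨2 * Real.Gamma (3/2) * k * Real.pi / (m * N), by have := Real.pi_pos; positivity, ?_⟩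
  rw [show (3 + 2 * t * I : ℂ) = 2 * (3/2 + 2 * u) by rw [mul_assoc, htu]; ring, htu]
  have hm' : (m : ℂ) ≠ 0 := by exact_mod_cast h2p.ne'
  have hN' : (N : ℂ) ≠ 0 := by exact_mod_cast hNp.ne'
  have hk' : (k : ℂ) ≠ 0 := by exact_mod_cast hk0.ne'
  rw [eq_div_iff (mul_ne_zero hm' hH0)] at hr
  push_cast
  generalize Gamma (1/2 + u) = A1 at *
  generalize Gamma (1 + u) = A2 at *
  generalize Gamma (1/4 + u) = A3 at *
  generalize Gamma (5/4 + u) = A4 at *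
  generalize Gamma (3/4 + u) = A5 at *
  generalize Gamma (3/2 + 2 * u) = A6 at *
  generalize Gamma (1 + 2 * u) = A7 at *
  generalize (2:ℂ) ^ (-(2 * u)) = E at *
  generalize (starRingEnd ℂ) A5 = A5c at *
  generalize betaIntegral (1 + 2 * u) (3/2) = B at *
  generalize (3/2 + 2 * u) = w at *
  generalize ((Real.sqrt Real.pi : ℝ) : ℂ) = sp at *
  generalize ((Real.Gamma (3/2) : ℝ) : ℂ) = g at *
  have hB : w * B = A7 * g / A6 := by rw [hb]; field_simp
  have hA7 : A7 = A1 * A2 / (E * sp) := by rw [d1]; field_simp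
  have hA6 : A6 = A5 * A4 / (k * E * sp) := by rw [d2]; field_simp
  have hHe : H = Real.pi / (A3 * A5c * m) := by
    have : A5c ≠ 0 := by rintro rfl; simp at hN; exact hN' hN.symm
    rw [← hr]; field_simp
  have : A5c ≠ 0 := by rintro rfl; simp at hN; exact hN' hN.symm
  rw [show 2 * w * B * H = 2 * (w * B) * H by ring, hB, hA7, hA6, hHe, ← hN]
  field_simp

/-- For every real `t > 0`, `Q(t) > 0`. -/
theorem Q_pos (t : ℝ) (ht : 0 < t) : 0 < Q t := by
  obtain ⟨c, hc, h⟩ := aux_main t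
  have hG := aux_G_im (t/2) (by positivity)
  have him := congrArg Complex.im h
  rw [Complex.im_ofReal_mul] at him
  have hpos := mul_pos hc hG
  rw [← him, aux_beta] at hpos
  have hch := Real.cosh_pos (Real.pi * t / 2)
  unfold Q
  rw [Real.tanh_eq_sinh_div_cosh]
  generalize (∫ s in (0:ℝ)..1, Real.cos (t * Real.log s) * Real.sqrt (1 - s)) = C at *
  generalize (∫ s in (0:ℝ)..1, Real.sin (t * Real.log s) * Real.sqrt (1 - s)) = S at *
  generalize Real.cosh (Real.pi * t / 2) = p at *
  generalize Real.sinh (Real.pi * t / 2) = q at *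
  simp at hpos
  have : C * (2 * t + 3 * (q / p)) + S * (3 - 2 * t * (q / p)) =
     ((3 * C - 2 * t * S) * q + (3 * S + 2 * t * C) * p) / p := by
    field_simp
    ring
  rw [this]
  apply div_pos _ hch
  linarith
end

section
/- The function Q is strictly increasing on the interval (0, 2/π]. -/
open Real Set Filter Topology MeasureTheory

/-- The weight. -/
noncomputable def qW (s : ℝ) : ℝ := (√(1 - s))⁻¹

lemma q_cont_aux (f g : ℝ → ℝ) (c : ℝ) (hf : Continuous f) (f0 : f 0 = 0) (hg : Continuous g)
    (hb : ∀ u, |g u| ≤ c) : Continuous (fun s => f s * g (Real.log s)) := by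
  rw [continuous_iff_continuousAt]
  intro s
  by_cases hs : s = 0
  · subst hs
    have h1 : Tendsto f (𝓝 0) (𝓝 0) := by simpa [f0] using hf.tendsto 0
    have h2 : Tendsto (fun s => |f s| * c) (𝓝 0) (𝓝 0) := by
      simpa using (h1.abs).mul_const c
    unfold ContinuousAt
    simp only [f0, zero_mul]
    refine squeeze_zero_norm (fun s => ?_) h2
    rw [Real.norm_eq_abs, abs_mul]
    exact mul_le_mul_of_nonneg_left (hb _) (abs_nonneg _)
  · exact hf.continuousAt.mul (hg.continuousAt.comp (Real.continuousAt_log hs))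

lemma q_bdd (t α β u : ℝ) : |α * Real.cos (t * u) + β * Real.sin (t * u)| ≤ |α| + |β| := by
  refine (abs_add_le _ _).trans ?_
  rw [abs_mul, abs_mul]
  have h1 := Real.abs_cos_le_one (t * u)
  have h2 := Real.abs_sin_le_one (t * u)
  nlinarith [abs_nonneg α, abs_nonneg β]

lemma q_cont (n : ℕ) (t α β γ δ : ℝ) : Continuous (fun s : ℝ =>
    s ^ (n + 1) * (α * Real.cos (t * Real.log s) + β * Real.sin (t * Real.log s)) +
    (s ^ n * (s * Real.log s)) *
      (γ * Real.cos (t * Real.log s) + δ * Real.sin (t * Real.log s))) := by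
  refine Continuous.add ?_ ?_
  · exact q_cont_aux (fun s => s ^ (n + 1))
      (fun u => α * Real.cos (t * u) + β * Real.sin (t * u)) _ (by fun_prop) (by simp)
      (by fun_prop) (q_bdd t α β)
  · exact q_cont_aux (fun s => s ^ n * (s * Real.log s))
      (fun u => γ * Real.cos (t * u) + δ * Real.sin (t * u)) _
      ((continuous_pow n).mul Real.continuous_mul_log) (by simp)
      (by fun_prop) (q_bdd t γ δ)

lemma q_bm (f g : ℝ → ℝ) (c : ℝ) (hf : IntervalIntegrable f volume 0 1) (hg : Measurable g)
    (hb : ∀ s, |g s| ≤ c) : IntervalIntegrable (fun s => g s * f s) volume 0 1 := by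
  rw [intervalIntegrable_iff] at hf ⊢
  exact hf.bdd_mul hg.aestronglyMeasurable (Eventually.of_forall hb)

lemma q_ii_log (n : ℕ) : IntervalIntegrable (fun s => s ^ n * Real.log s) volume 0 1 :=
  (intervalIntegral.intervalIntegrable_log').continuousOn_mul (by fun_prop)

lemma q_ii_pow (n : ℕ) : IntervalIntegrable (fun s : ℝ => s ^ n) volume 0 1 :=
  (continuous_pow n).intervalIntegrable _ _

lemma q_ii_cos (t : ℝ) {f : ℝ → ℝ} (hf : IntervalIntegrable f volume 0 1) :
    IntervalIntegrable (fun s => Real.cos (t * Real.log s) * f s) volume 0 1 :=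
  q_bm f _ 1 hf (by fun_prop) (fun s => Real.abs_cos_le_one _)

lemma q_ii_sin (t : ℝ) {f : ℝ → ℝ} (hf : IntervalIntegrable f volume 0 1) :
    IntervalIntegrable (fun s => Real.sin (t * Real.log s) * f s) volume 0 1 :=
  q_bm f _ 1 hf (by fun_prop) (fun s => Real.abs_sin_le_one _)

lemma q_d_cos (t : ℝ) {s : ℝ} (hs : 0 < s) : HasDerivAt (fun s => Real.cos (t * Real.log s))
    (-Real.sin (t * Real.log s) * (t * s⁻¹)) s :=
  ((Real.hasDerivAt_log hs.ne').const_mul t).cos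

lemma q_d_sin (t : ℝ) {s : ℝ} (hs : 0 < s) : HasDerivAt (fun s => Real.sin (t * Real.log s))
    (Real.cos (t * Real.log s) * (t * s⁻¹)) s :=
  ((Real.hasDerivAt_log hs.ne').const_mul t).sin

lemma q_d (n : ℕ) (t α β γ δ : ℝ) {s : ℝ} (hs : 0 < s) : HasDerivAt (fun s : ℝ =>
    s ^ (n + 1) * (α * Real.cos (t * Real.log s) + β * Real.sin (t * Real.log s)) +
    (s ^ n * (s * Real.log s)) *
      (γ * Real.cos (t * Real.log s) + δ * Real.sin (t * Real.log s)))
    (Real.cos (t * Real.log s) * s ^ n * ((n + 1) * α + t * β + γ) +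
     Real.sin (t * Real.log s) * s ^ n * ((n + 1) * β - t * α + δ) +
     Real.cos (t * Real.log s) * (s ^ n * Real.log s) * ((n + 1) * γ + t * δ) +
     Real.sin (t * Real.log s) * (s ^ n * Real.log s) * ((n + 1) * δ - t * γ)) s := by
  have hc := q_d_cos t hs
  have hsn := q_d_sin t hs
  have hl := Real.hasDerivAt_log hs.ne'
  have hp := hasDerivAt_pow (n + 1) s
  have e : (fun s : ℝ =>
    s ^ (n + 1) * (α * Real.cos (t * Real.log s) + β * Real.sin (t * Real.log s)) +
    (s ^ n * (s * Real.log s)) *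
      (γ * Real.cos (t * Real.log s) + δ * Real.sin (t * Real.log s))) = (fun s : ℝ =>
    s ^ (n + 1) * (α * Real.cos (t * Real.log s) + β * Real.sin (t * Real.log s)) +
    (s ^ (n + 1) * Real.log s) *
      (γ * Real.cos (t * Real.log s) + δ * Real.sin (t * Real.log s))) := by
    funext s; ring
  rw [e]
  have := (hp.mul ((hc.const_mul α).add (hsn.const_mul β))).add
    ((hp.mul hl).mul ((hc.const_mul γ).add (hsn.const_mul δ)))
  refine this.congr_deriv ?_
  simp only [Pi.mul_apply, Pi.add_apply, Nat.add_sub_cancel]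
  push_cast
  field_simp
  ring

lemma q_int (n : ℕ) (t α β γ δ : ℝ) :
    ∫ s in (0:ℝ)..1, (Real.cos (t * Real.log s) * s ^ n * ((n + 1) * α + t * β + γ) +
     Real.sin (t * Real.log s) * s ^ n * ((n + 1) * β - t * α + δ) +
     Real.cos (t * Real.log s) * (s ^ n * Real.log s) * ((n + 1) * γ + t * δ) +
     Real.sin (t * Real.log s) * (s ^ n * Real.log s) * ((n + 1) * δ - t * γ)) = α := by
  rw [intervalIntegral.integral_eq_sub_of_hasDerivAt_of_le (by norm_num)
    (q_cont n t α β γ δ).continuousOn (fun s hs => q_d n t α β γ δ hs.1)]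
  · simp
  · exact ((((q_ii_cos t (q_ii_pow n)).mul_const _).add
      ((q_ii_sin t (q_ii_pow n)).mul_const _)).add
      ((q_ii_cos t (q_ii_log n)).mul_const _)).add ((q_ii_sin t (q_ii_log n)).mul_const _)

lemma q_int_cos (n : ℕ) (t : ℝ) : ∫ s in (0:ℝ)..1, Real.cos (t * Real.log s) * s ^ n =
    (n + 1) / ((n + 1) ^ 2 + t ^ 2) := by
  have hm : ((n : ℝ) + 1) ^ 2 + t ^ 2 ≠ 0 := by positivity
  rw [← q_int n t ((n + 1) / ((n + 1) ^ 2 + t ^ 2)) (t / ((n + 1) ^ 2 + t ^ 2)) 0 0]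
  congr 1; funext s; field_simp; ring

lemma q_int_logsin (n : ℕ) (t : ℝ) :
    ∫ s in (0:ℝ)..1, Real.sin (t * Real.log s) * (s ^ n * Real.log s) =
    2 * (n + 1) * t / ((n + 1) ^ 2 + t ^ 2) ^ 2 := by
  have hm : ((n : ℝ) + 1) ^ 2 + t ^ 2 ≠ 0 := by positivity
  rw [← q_int n t (2 * (n + 1) * t / ((n + 1) ^ 2 + t ^ 2) ^ 2)
    (-((n + 1) ^ 2 - t ^ 2) / ((n + 1) ^ 2 + t ^ 2) ^ 2)
    (-t / ((n + 1) ^ 2 + t ^ 2)) ((n + 1) / ((n + 1) ^ 2 + t ^ 2))]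
  congr 1; funext s; field_simp; ring

lemma q_int_logcos (n : ℕ) (t : ℝ) :
    ∫ s in (0:ℝ)..1, Real.cos (t * Real.log s) * (s ^ n * Real.log s) =
    -((n + 1) ^ 2 - t ^ 2) / ((n + 1) ^ 2 + t ^ 2) ^ 2 := by
  have hm : ((n : ℝ) + 1) ^ 2 + t ^ 2 ≠ 0 := by positivity
  rw [← q_int n t (-((n + 1) ^ 2 - t ^ 2) / ((n + 1) ^ 2 + t ^ 2) ^ 2)
    (-(2 * (n + 1) * t) / ((n + 1) ^ 2 + t ^ 2) ^ 2)
    ((n + 1) / ((n + 1) ^ 2 + t ^ 2)) (t / ((n + 1) ^ 2 + t ^ 2))]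
  congr 1; funext s; field_simp; ring

lemma q_d_sqrt {s : ℝ} (hs : s < 1) : HasDerivAt (fun s => √(1 - s)) (-qW s / 2) s := by
  have h : HasDerivAt (fun s : ℝ => 1 - s) (-1) s := by
    simpa using (hasDerivAt_id s).const_sub 1
  have h0 : (1 - s) ≠ 0 := by linarith
  refine (h.sqrt h0).congr_deriv ?_
  have : √(1 - s) ≠ 0 := (Real.sqrt_pos.2 (by linarith)).ne'
  unfold qW; field_simp

lemma q_W_nonneg (s : ℝ) : 0 ≤ qW s := by unfold qW; positivity

lemma q_W_aux : IntervalIntegrable qW volume 0 1 ∧ ∫ s in (0:ℝ)..1, qW s = 2 := by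
  have hc : ContinuousOn (fun s => -2 * √(1 - s)) (Icc (0:ℝ) 1) := by fun_prop
  have hd : ∀ s ∈ Ioo (0:ℝ) 1, HasDerivAt (fun s => -2 * √(1 - s)) (qW s) s := by
    intro s hs
    refine ((q_d_sqrt hs.2).const_mul (-2)).congr_deriv ?_
    ring
  have hi : IntervalIntegrable qW volume 0 1 := by
    rw [intervalIntegrable_iff, uIoc_of_le zero_le_one]
    exact intervalIntegral.integrableOn_deriv_of_nonneg hc hd (fun s _ => q_W_nonneg s)
  refine ⟨hi, ?_⟩
  rw [intervalIntegral.integral_eq_sub_of_hasDerivAt_of_le (by norm_num) hc hd hi]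
  simp

lemma q_LW_aux : IntervalIntegrable (fun s => Real.log s * qW s) volume 0 1 ∧
    ∫ s in (0:ℝ)..1, Real.log s * qW s = 4 * Real.log 2 - 4 := by
  let F : ℝ → ℝ := fun x => 2 * (-((1 - x) * Real.log (1 - x)) + (1 + x) * Real.log (1 + x) - 2 * x)
  have hF : Continuous F := by
    have h1 := Real.continuous_mul_log.comp (show Continuous (fun x : ℝ => 1 - x) by fun_prop)
    have h2 := Real.continuous_mul_log.comp (show Continuous (fun x : ℝ => 1 + x) by fun_prop)
    exact ((h1.neg.add h2).sub (by fun_prop)).const_mul 2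
  have hc : ContinuousOn (fun s => F √(1 - s)) (Icc (0:ℝ) 1) := by fun_prop
  have hd : ∀ s ∈ Ioo (0:ℝ) 1, HasDerivAt (fun s => F √(1 - s)) (-(Real.log s * qW s)) s := by
    intro s hs
    have hx0 : 0 < √(1 - s) := Real.sqrt_pos.2 (by linarith [hs.2])
    have hx1 : √(1 - s) < 1 := by
      rw [Real.sqrt_lt' one_pos]; linarith [hs.1]
    have hxx : √(1 - s) ^ 2 = 1 - s := Real.sq_sqrt (by linarith [hs.2])
    set x := √(1 - s) with hx
    have hFd : HasDerivAt F (2 * Real.log s) x := by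
      have a1 : HasDerivAt (fun x : ℝ => 1 - x) (-1) x := by
        simpa using (hasDerivAt_id x).const_sub 1
      have a2 : HasDerivAt (fun x : ℝ => 1 + x) 1 x := by
        simpa using (hasDerivAt_id x).const_add 1
      have b1 := a1.mul (a1.log (by linarith))
      have b2 := a2.mul (a2.log (by linarith))
      refine (((b1.neg.add b2).sub ((hasDerivAt_id x).const_mul 2)).const_mul 2).congr_deriv ?_
      have e : s = (1 - x) * (1 + x) := by nlinarith
      rw [e, Real.log_mul (by linarith) (by linarith)]
      have h1 : (1 - x) ≠ 0 := by linarith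
      have h2 : (1 + x) ≠ 0 := by linarith
      field_simp
      ring
    refine (HasDerivAt.comp s hFd (q_d_sqrt hs.2)).congr_deriv ?_
    ring
  have hi : IntervalIntegrable (fun s => -(Real.log s * qW s)) volume 0 1 := by
    rw [intervalIntegrable_iff, uIoc_of_le zero_le_one]
    refine intervalIntegral.integrableOn_deriv_of_nonneg hc hd (fun s hs => ?_)
    have := Real.log_nonpos hs.1.le hs.2.le
    nlinarith [q_W_nonneg s]
  refine ⟨by have h := hi.neg; simpa [Pi.neg_def] using h, ?_⟩
  have := intervalIntegral.integral_eq_sub_of_hasDerivAt_of_le (by norm_num) hc hd hi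
  rw [intervalIntegral.integral_neg] at this
  have e : F √(1 - 1) - F √(1 - 0) = 4 - 4 * Real.log 2 := by
    simp only [F]; norm_num; ring
  linarith

/-- Partial sum of the weight. -/
noncomputable def qP (s : ℝ) : ℝ := 1 + s / 2 + 3 / 8 * s ^ 2 + 5 / 16 * s ^ 3

lemma q_P_le {s : ℝ} (h0 : 0 < s) (h1 : s < 1) : qP s ≤ qW s := by
  have hx0 : 0 < √(1 - s) := Real.sqrt_pos.2 (by linarith)
  have hxx : √(1 - s) ^ 2 = 1 - s := Real.sq_sqrt (by linarith)
  have hP : 0 < qP s := by unfold qP; positivity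
  unfold qW
  rw [le_inv_comm₀ hP hx0, Real.sqrt_le_left (by positivity)]
  rw [inv_pow, le_inv_comm₀ (by linarith) (by positivity), ← one_div,
    le_div_iff₀ (by linarith)]
  have : qP s ^ 2 * (1 - s) = 1 - s ^ 4 * (35 / 64 + 7 / 32 * s + 35 / 256 * s ^ 2 + 25 / 256 * s ^ 3
     ) + 0 := by
    unfold qP; ring
  have h4 : 0 ≤ s ^ 4 * (35 / 64 + 7 / 32 * s + 35 / 256 * s ^ 2 + 25 / 256 * s ^ 3) := by
    positivity
  linarith

lemma q_W_le {s : ℝ} (h0 : 0 < s) (h1 : s < 1) :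
    qW s ≤ qP s + 35 / 128 * s ^ 4 / (1 - s) := by
  have hx0 : 0 < √(1 - s) := Real.sqrt_pos.2 (by linarith)
  have hxx : √(1 - s) ^ 2 = 1 - s := Real.sq_sqrt (by linarith)
  have key : √(1 - s) ≤ (1 - s) * qP s + 35 / 128 * s ^ 4 := by
    rw [Real.sqrt_le_left (by unfold qP; have : 0 < 1 - s := by linarith
                              positivity)]
    have : ((1 - s) * qP s + 35 / 128 * s ^ 4) ^ 2 = 1 - s + s ^ 5 *
      (7 / 128 + 7 / 512 * s + 5 / 1024 * s ^ 2 + 25 / 16384 * s ^ 3) := by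
      unfold qP; ring
    have h4 : 0 ≤ s ^ 5 *
      (7 / 128 + 7 / 512 * s + 5 / 1024 * s ^ 2 + 25 / 16384 * s ^ 3) := by positivity
    linarith
  unfold qW
  have e : qP s + 35 / 128 * s ^ 4 / (1 - s) =
    ((1 - s) * qP s + 35 / 128 * s ^ 4) / (1 - s) := by
    have : (1 - s) ≠ 0 := by linarith
    field_simp
  rw [e, le_div_iff₀ (by linarith)]
  calc (√(1 - s))⁻¹ * (1 - s) = (√(1 - s))⁻¹ * √(1 - s) ^ 2 := by rw [hxx]
    _ = √(1 - s) := by field_simp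
    _ ≤ _ := key

lemma q_rho {s : ℝ} (h0 : 0 < s) (h1 : s < 1) :
    Real.log s ^ 2 * (qW s - qP s) ≤ 35 / 128 * (s ^ 2 - s ^ 3) := by
  have a1 := Real.log_nonpos h0.le h1.le
  have a2 := Real.one_sub_inv_le_log_of_pos h0
  have a3 : Real.log s ^ 2 ≤ (s⁻¹ - 1) ^ 2 := by
    apply sq_le_sq'; · linarith
    linarith
  have b1 := q_W_le h0 h1
  have b2 := q_P_le h0 h1
  calc Real.log s ^ 2 * (qW s - qP s) ≤ (s⁻¹ - 1) ^ 2 * (35 / 128 * s ^ 4 / (1 - s)) := by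
        apply mul_le_mul a3 (by linarith) (by linarith) (by positivity)
    _ = 35 / 128 * (s ^ 2 - s ^ 3) := by
        have : (1 - s) ≠ 0 := by linarith
        field_simp

lemma q_int_pow (n : ℕ) : ∫ s in (0:ℝ)..1, s ^ n = 1 / (n + 1) := by
  simp [integral_pow]

lemma q_int4 (f : ℝ → ℝ) (h : ∀ n : ℕ, IntervalIntegrable (fun s => f s * s ^ n) volume 0 1) :
    IntervalIntegrable (fun s => f s * qP s) volume 0 1 ∧ 
    ∫ s in (0:ℝ)..1, f s * qP s = (∫ s in (0:ℝ)..1, f s * s ^ 0)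
      + 1 / 2 * (∫ s in (0:ℝ)..1, f s * s ^ 1) + 3 / 8 * (∫ s in (0:ℝ)..1, f s * s ^ 2)
      + 5 / 16 * (∫ s in (0:ℝ)..1, f s * s ^ 3) := by
  have e : (fun s => f s * qP s) = (fun s => f s * s ^ 0 + 1 / 2 * (f s * s ^ 1) +
      3 / 8 * (f s * s ^ 2) + 5 / 16 * (f s * s ^ 3)) := by
    funext s; unfold qP; ring
  have h0 := h 0
  have h1 := (h 1).const_mul (1 / 2)
  have h2 := (h 2).const_mul (3 / 8)
  have h3 := (h 3).const_mul (5 / 16)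
  rw [e]
  refine ⟨((h0.add h1).add h2).add h3, ?_⟩
  rw [intervalIntegral.integral_add ((h0.add h1).add h2) h3,
    intervalIntegral.integral_add (h0.add h1) h2, intervalIntegral.integral_add h0 h1]
  simp only [intervalIntegral.integral_const_mul]

lemma q_rho_int : IntervalIntegrable (fun s : ℝ => 35 / 128 * (s ^ 2 - s ^ 3)) volume 0 1 ∧
    ∫ s in (0:ℝ)..1, 35 / 128 * (s ^ 2 - s ^ 3) = 35 / 1536 := by
  refine ⟨(by fun_prop : Continuous (fun s : ℝ => 35 / 128 * (s ^ 2 - s ^ 3))).intervalIntegrable _ _, ?_⟩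
  rw [intervalIntegral.integral_const_mul, intervalIntegral.integral_sub (q_ii_pow 2) (q_ii_pow 3),
    q_int_pow, q_int_pow]
  norm_num

lemma q_C_ge (t : ℝ) : 2 - (1 + 1 / 4 + 1 / 8 + 5 / 64) + (1 / (1 + t ^ 2) + 1 / (4 + t ^ 2) +
    9 / 8 / (9 + t ^ 2) + 5 / 4 / (16 + t ^ 2)) - t ^ 2 / 2 * (35 / 1536) ≤
    ∫ s in (0:ℝ)..1, Real.cos (t * Real.log s) * qW s := by
  obtain ⟨i1, e1⟩ := q_W_aux
  obtain ⟨i2, e2⟩ := q_int4 (fun _ => 1) (fun n => by simp)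
  obtain ⟨i3, e3⟩ := q_int4 (fun s => Real.cos (t * Real.log s)) (fun n => q_ii_cos t (q_ii_pow n))
  obtain ⟨i4, e4⟩ := q_rho_int
  simp only [q_int_cos] at e3
  simp only [one_mul, q_int_pow] at e2 i2
  have := intervalIntegral.integral_mono_on_of_le_Ioo (f := fun s => qW s - qP s +
    Real.cos (t * Real.log s) * qP s - t ^ 2 / 2 * (35 / 128 * (s ^ 2 - s ^ 3))) zero_le_one
    (((i1.sub i2).add i3).sub (i4.const_mul _)) (q_ii_cos t i1) (by
      intro s hs
      have h1 := q_rho hs.1 hs.2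
      have h2 := q_P_le hs.1 hs.2
      have h3 := Real.one_sub_sq_div_two_le_cos (x := t * Real.log s)
      have h4 : (1 - Real.cos (t * Real.log s)) * (qW s - qP s) ≤
        (t * Real.log s) ^ 2 / 2 * (qW s - qP s) :=
        mul_le_mul_of_nonneg_right (by linarith) (by linarith)
      have h5 := mul_le_mul_of_nonneg_left h1 (show 0 ≤ t ^ 2 / 2 by positivity)
      nlinarith)
  rw [intervalIntegral.integral_sub ((i1.sub i2).add i3) (i4.const_mul _),
    intervalIntegral.integral_add (i1.sub i2) i3, intervalIntegral.integral_sub i1 i2,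
    intervalIntegral.integral_const_mul, e1, e2, e3, e4] at this
  refine le_trans (le_of_eq ?_) this
  norm_num
  ring

lemma q_S_le (t : ℝ) (ht : 0 ≤ t) : 
    ∫ s in (0:ℝ)..1, Real.sin (t * Real.log s) * (Real.log s * qW s) ≤
    2 * t / (1 + t ^ 2) ^ 2 + 2 * t / (4 + t ^ 2) ^ 2 + 9 / 4 * t / (9 + t ^ 2) ^ 2 +
     5 / 2 * t / (16 + t ^ 2) ^ 2 + t * (35 / 1536) := by
  obtain ⟨i1, e1⟩ := q_LW_aux
  obtain ⟨i3, e3⟩ := q_int4 (fun s => Real.sin (t * Real.log s) * Real.log s)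
    (fun n => (q_ii_sin t (q_ii_log n)).congr (fun s _ => by ring))
  obtain ⟨i4, e4⟩ := q_rho_int
  have r : ∀ n : ℕ, (∫ s in (0:ℝ)..1, Real.sin (t * Real.log s) * Real.log s * s ^ n) =
      2 * (n + 1) * t / ((n + 1) ^ 2 + t ^ 2) ^ 2 := by
    intro n
    rw [← q_int_logsin]; congr 1; funext s; ring
  simp only [r] at e3
  have := intervalIntegral.integral_mono_on_of_le_Ioo (g := fun s => 
    Real.sin (t * Real.log s) * Real.log s * qP s + t * (35 / 128 * (s ^ 2 - s ^ 3))) zero_le_one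
    (q_ii_sin t i1) (i3.add (i4.const_mul _)) (by
      intro s hs
      have h1 := q_rho hs.1 hs.2
      have h2 := q_P_le hs.1 hs.2
      have hl := Real.log_nonpos hs.1.le hs.2.le
      have h3 : Real.sin (t * Real.log s) * Real.log s ≤ t * Real.log s ^ 2 := by
        have h := Real.sin_le (x := t * -Real.log s) (by nlinarith)
        rw [mul_neg, Real.sin_neg] at h
        nlinarith
      have h4 := mul_le_mul_of_nonneg_right h3 (sub_nonneg.2 h2)
      have h5 := mul_le_mul_of_nonneg_left h1 ht
      nlinarith)
  rw [intervalIntegral.integral_add i3 (i4.const_mul _),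
    intervalIntegral.integral_const_mul, e3, e4] at this
  refine le_trans this (le_of_eq ?_)
  norm_num
  ring

lemma q_D_ge (t : ℝ) : 4 * Real.log 2 - 4 + (1 + 1 / 8 + 1 / 24 + 5 / 256) -
    ((1 - t ^ 2) / (1 + t ^ 2) ^ 2 + 1 / 2 * (4 - t ^ 2) / (4 + t ^ 2) ^ 2 +
     3 / 8 * (9 - t ^ 2) / (9 + t ^ 2) ^ 2 + 5 / 16 * (16 - t ^ 2) / (16 + t ^ 2) ^ 2) ≤
    ∫ s in (0:ℝ)..1, Real.cos (t * Real.log s) * (Real.log s * qW s) := by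
  obtain ⟨i1, e1⟩ := q_LW_aux
  have H : ∀ t, IntervalIntegrable (fun s => Real.cos (t * Real.log s) * Real.log s * qP s)
      volume 0 1 ∧ (∫ s in (0:ℝ)..1, Real.cos (t * Real.log s) * Real.log s * qP s) =
      -(((1 - t ^ 2) / (1 + t ^ 2) ^ 2 + 1 / 2 * (4 - t ^ 2) / (4 + t ^ 2) ^ 2 +
     3 / 8 * (9 - t ^ 2) / (9 + t ^ 2) ^ 2 + 5 / 16 * (16 - t ^ 2) / (16 + t ^ 2) ^ 2)) := by
    intro t
    obtain ⟨i3, e3⟩ := q_int4 (fun s => Real.cos (t * Real.log s) * Real.log s)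
      (fun n => (q_ii_cos t (q_ii_log n)).congr (fun s _ => by ring))
    have r : ∀ n : ℕ, (∫ s in (0:ℝ)..1, Real.cos (t * Real.log s) * Real.log s * s ^ n) =
        -((n + 1) ^ 2 - t ^ 2) / ((n + 1) ^ 2 + t ^ 2) ^ 2 := by
      intro n
      rw [← q_int_logcos]; congr 1; funext s; ring
    simp only [r] at e3
    refine ⟨i3, e3.trans ?_⟩
    norm_num
    ring
  obtain ⟨i2, e2⟩ := H 0
  obtain ⟨i3, e3⟩ := H t
  simp only [zero_mul, Real.cos_zero, one_mul] at i2 e2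
  have := intervalIntegral.integral_mono_on_of_le_Ioo (f := fun s => 
    Real.log s * qW s - Real.log s * qP s + Real.cos (t * Real.log s) * Real.log s * qP s)
    zero_le_one ((i1.sub i2).add i3) (q_ii_cos t i1) (by
      intro s hs
      have h2 := q_P_le hs.1 hs.2
      have hl := Real.log_nonpos hs.1.le hs.2.le
      have h3 := Real.cos_le_one (t * Real.log s)
      have h4 := mul_nonneg (mul_nonneg (sub_nonneg.2 h3) (neg_nonneg.2 hl)) (sub_nonneg.2 h2)
      nlinarith)
  rw [intervalIntegral.integral_add (i1.sub i2) i3, intervalIntegral.integral_sub i1 i2,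
    e1, e2, e3] at this
  refine le_trans (le_of_eq ?_) this
  norm_num
  ring

lemma q_tanh_aux1 {x : ℝ} (hx : 0 ≤ x) : 0 ≤ x * Real.cosh x - Real.sinh x := by
  have hm : MonotoneOn (fun x => x * Real.cosh x - Real.sinh x) (Ici 0) := by
    refine monotoneOn_of_hasDerivWithinAt_nonneg (convex_Ici 0) (by fun_prop)
      (f' := fun x => x * Real.sinh x) (fun x _ => ?_) (fun x hx => ?_)
    · refine (((hasDerivAt_id x).mul (Real.hasDerivAt_cosh x)).sub
        (Real.hasDerivAt_sinh x)).hasDerivWithinAt.congr_deriv ?_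
      simp
    · rw [interior_Ici] at hx
      have hx' : 0 < x := hx
      exact mul_nonneg hx'.le (Real.sinh_nonneg_iff.2 hx'.le)
  have := hm (self_mem_Ici) (show x ∈ Ici (0:ℝ) from hx) hx
  simpa using this

lemma q_tanh_aux2 {x : ℝ} (hx : 0 ≤ x) :
    0 ≤ (3 + x ^ 2) * Real.sinh x - 3 * x * Real.cosh x := by
  have hm : MonotoneOn (fun x => (3 + x ^ 2) * Real.sinh x - 3 * x * Real.cosh x) (Ici 0) := by
    refine monotoneOn_of_hasDerivWithinAt_nonneg (convex_Ici 0) (by fun_prop)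
      (f' := fun x => x * (x * Real.cosh x - Real.sinh x)) (fun x _ => ?_) (fun x hx => ?_)
    · refine (((((hasDerivAt_id x).pow 2).const_add 3).mul (Real.hasDerivAt_sinh x)).sub
        (((hasDerivAt_id x).const_mul 3).mul (Real.hasDerivAt_cosh x))).hasDerivWithinAt.congr_deriv ?_
      simp
      ring
    · rw [interior_Ici] at hx
      have hx' : 0 < x := hx
      exact mul_nonneg hx'.le (q_tanh_aux1 hx'.le)
  have := hm (self_mem_Ici) (show x ∈ Ici (0:ℝ) from hx) hx
  simpa using this

lemma q_tanh_aux3 {x : ℝ} (hx : 0 ≤ x) :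
    0 ≤ x * (15 + x ^ 2) * Real.cosh x - (15 + 6 * x ^ 2) * Real.sinh x := by
  have hm : MonotoneOn
      (fun x => x * (15 + x ^ 2) * Real.cosh x - (15 + 6 * x ^ 2) * Real.sinh x) (Ici 0) := by
    refine monotoneOn_of_hasDerivWithinAt_nonneg (convex_Ici 0) (by fun_prop)
      (f' := fun x => x * ((3 + x ^ 2) * Real.sinh x - 3 * x * Real.cosh x))
      (fun x _ => ?_) (fun x hx => ?_)
    · refine ((((hasDerivAt_id x).mul (((hasDerivAt_id x).pow 2).const_add 15)).mul
        (Real.hasDerivAt_cosh x)).sub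
        (((((hasDerivAt_id x).pow 2).const_mul 6).const_add 15).mul
        (Real.hasDerivAt_sinh x))).hasDerivWithinAt.congr_deriv ?_
      simp
      ring
    · rw [interior_Ici] at hx
      have hx' : 0 < x := hx
      exact mul_nonneg hx'.le (q_tanh_aux2 hx'.le)
  have := hm (self_mem_Ici) (show x ∈ Ici (0:ℝ) from hx) hx
  simpa using this

lemma q_tanh_le {x : ℝ} (hx : 0 ≤ x) :
    Real.tanh x ≤ x * ((15 + x ^ 2) / (15 + 6 * x ^ 2)) := by
  have := q_tanh_aux3 hx
  rw [Real.tanh_eq_sinh_div_cosh, div_le_iff₀ (Real.cosh_pos x)]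
  have h : 0 < 15 + 6 * x ^ 2 := by positivity
  have e : x * ((15 + x ^ 2) / (15 + 6 * x ^ 2)) * Real.cosh x =
    (x * (15 + x ^ 2) * Real.cosh x) / (15 + 6 * x ^ 2) := by field_simp
  rw [e, le_div_iff₀ h]
  linarith

lemma q_final_poly {y : ℝ} (h0 : 0 ≤ y) (h1 : y ≤ 1) :
    0 < 157079 / 100000 * (1 - y * ((15 + y) / (15 + 6 * y)) ^ 2) *
      (2 - 2027 / 5000 * y / (1 + 1013 / 2500 * y) - 427 / 4608 * (2027 / 5000 * y))
      - 63663 / 100000 * (y * ((15 + y) / (15 + 6 * y))) *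
        (2 / (1 + 1013 / 2500 * y) ^ 2 + 427 / 2304 - 1351 / 25000 * (1013 / 2500 * y))
      + (4 * (6931 / 10000) - 4 + 1 - (1 - 1013 / 2500 * y) / (1 + 1013 / 2500 * y) ^ 2
        + 4103 / 36864 * (1013 / 2500 * y) - 669115 / 15925248 * (1013 / 2500 * y) ^ 2) := by
  have k1 : 0 < 15 + 6 * y := by positivity
  have k2 : 0 < 1 + 1013 / 2500 * y := by positivity
  refine pos_of_mul_pos_left (b := (15 + 6 * y) ^ 2 * (1 + 1013 / 2500 * y) ^ 2) ?_ (by positivity)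
  have e : ∀ a b : ℝ, a = b → 0 < b → 0 < a := fun a b h h' => h ▸ h'
  refine e _ ((861291 / 2000) * y ^ 0 + (-2040563234487 / 10240000000) * y ^ 1 + (-1242096095206939687 / 6912000000000000) * y ^ 2 + (-621878830920735383 / 45000000000000000) * y ^ 3 + (-51127509488129146463323 / 43200000000000000000000) * y ^ 4 + (-3865928318030134953101 / 18000000000000000000000) * y ^ 5 + (-4685497841741857546033 / 270000000000000000000000) * y ^ 6) ?_ ?_
  · field_simp
    ring
  · have p2 : y ^ 2 ≤ 1 := pow_le_one₀ h0 h1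
    have p3 : y ^ 3 ≤ 1 := pow_le_one₀ h0 h1
    have p4 : y ^ 4 ≤ 1 := pow_le_one₀ h0 h1
    have p5 : y ^ 5 ≤ 1 := pow_le_one₀ h0 h1
    have p6 : y ^ 6 ≤ 1 := pow_le_one₀ h0 h1
    linarith

lemma q_C_low {z y : ℝ} (hy : 0 ≤ y) (h1 : 1013 / 2500 * y ≤ z) (h2 : z ≤ 2027 / 5000 * y) :
    2 - 2027 / 5000 * y / (1 + 1013 / 2500 * y) - 427 / 4608 * (2027 / 5000 * y) ≤
    2 - (1 + 1 / 4 + 1 / 8 + 5 / 64) + (1 / (1 + z) + 1 / (4 + z) +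
    9 / 8 / (9 + z) + 5 / 4 / (16 + z)) - z / 2 * (35 / 1536) := by
  have hz : 0 ≤ z := by nlinarith
  have a1 : 1 - 2027 / 5000 * y / (1 + 1013 / 2500 * y) ≤ 1 / (1 + z) := by
    have : 1 / (1 + z) = 1 - z / (1 + z) := by field_simp; ring
    rw [this]
    have : z / (1 + z) ≤ 2027 / 5000 * y / (1 + 1013 / 2500 * y) :=
      div_le_div₀ (by positivity) h2 (by positivity) (by linarith)
    linarith
  have a2 : 1 / 4 - 1 / 16 * z ≤ 1 / (4 + z) := by
    rw [le_div_iff₀ (by positivity)]; nlinarith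
  have a3 : 1 / 8 - 1 / 72 * z ≤ 9 / 8 / (9 + z) := by
    rw [le_div_iff₀ (by positivity)]; nlinarith
  have a4 : 5 / 64 - 5 / 1024 * z ≤ 5 / 4 / (16 + z) := by
    rw [le_div_iff₀ (by positivity)]; nlinarith
  linarith

lemma q_S_up {z y : ℝ} (hy : 0 ≤ y) (hy1 : y ≤ 1) (h1 : 1013 / 2500 * y ≤ z)
    (h2 : z ≤ 2027 / 5000 * y) :
    2 / (1 + z) ^ 2 + 2 / (4 + z) ^ 2 + 9 / 4 / (9 + z) ^ 2 + 5 / 2 / (16 + z) ^ 2 + 35 / 1536 ≤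
    2 / (1 + 1013 / 2500 * y) ^ 2 + 427 / 2304 - 1351 / 25000 * (1013 / 2500 * y) := by
  have hz : 0 ≤ z := by nlinarith
  have hz1 : z ≤ 41 / 100 := by linarith
  have a1 : 2 / (1 + z) ^ 2 ≤ 2 / (1 + 1013 / 2500 * y) ^ 2 := by gcongr
  have a2 : 2 / (4 + z) ^ 2 ≤ 1 / 8 - 1351 / 25000 * z := by
    rw [div_le_iff₀ (by positivity)]
    nlinarith [mul_nonneg hz (sub_nonneg.2 hz1), mul_nonneg (mul_nonneg hz hz) (sub_nonneg.2 hz1)]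
  have a3 : 9 / 4 / (9 + z) ^ 2 ≤ 1 / 36 := by
    rw [div_le_iff₀ (by positivity)]; nlinarith
  have a4 : 5 / 2 / (16 + z) ^ 2 ≤ 5 / 512 := by
    rw [div_le_iff₀ (by positivity)]; nlinarith
  linarith

lemma q_D_up {z k : ℝ} (hz : 0 ≤ z) (hk : 0 < k) :
    (k - z) / (k + z) ^ 2 ≤ 1 / k - 3 * z / k ^ 2 + 5 * z ^ 2 / k ^ 3 := by
  have e : 1 / k - 3 * z / k ^ 2 + 5 * z ^ 2 / k ^ 3 - (k - z) / (k + z) ^ 2 =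
    (7 * k * z ^ 3 + 5 * z ^ 4) / (k ^ 3 * (k + z) ^ 2) := by
    field_simp; ring
  have : 0 ≤ (7 * k * z ^ 3 + 5 * z ^ 4) / (k ^ 3 * (k + z) ^ 2) := by positivity
  linarith

lemma q_D_low {z y L : ℝ} (hy : 0 ≤ y) (hy1 : y ≤ 1) (h1 : 1013 / 2500 * y ≤ z)
    (h2 : z ≤ 2027 / 5000 * y) (hL : 6931 / 10000 ≤ L) :
    4 * (6931 / 10000) - 4 + 1 - (1 - 1013 / 2500 * y) / (1 + 1013 / 2500 * y) ^ 2
        + 4103 / 36864 * (1013 / 2500 * y) - 669115 / 15925248 * (1013 / 2500 * y) ^ 2 ≤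
    4 * L - 4 + (1 + 1 / 8 + 1 / 24 + 5 / 256) -
    ((1 - z) / (1 + z) ^ 2 + 1 / 2 * (4 - z) / (4 + z) ^ 2 +
     3 / 8 * (9 - z) / (9 + z) ^ 2 + 5 / 16 * (16 - z) / (16 + z) ^ 2) := by
  have hz : 0 ≤ z := by nlinarith
  have hz1 : z ≤ 41 / 100 := by linarith
  have a1 : (1 - z) / (1 + z) ^ 2 ≤ (1 - 1013 / 2500 * y) / (1 + 1013 / 2500 * y) ^ 2 := by
    apply div_le_div₀ (by linarith) (by linarith) (by positivity)
    gcongr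
  have a2 := q_D_up hz (show (0:ℝ) < 4 by norm_num)
  have a3 := q_D_up hz (show (0:ℝ) < 9 by norm_num)
  have a4 := q_D_up hz (show (0:ℝ) < 16 by norm_num)
  have a5 : 4103 / 36864 * (1013 / 2500 * y) - 669115 / 15925248 * (1013 / 2500 * y) ^ 2 ≤
    4103 / 36864 * z - 669115 / 15925248 * z ^ 2 := by
    nlinarith [mul_nonneg (sub_nonneg.2 h1) (show 0 ≤ 1 - z by linarith),
      mul_nonneg (sub_nonneg.2 h1) (show 0 ≤ 1 - 1013 / 2500 * y by linarith)]
  rw [mul_div_assoc, mul_div_assoc, mul_div_assoc]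
  linarith

lemma q_combine {p T t S C D q y h sg cl dl ph : ℝ} (hph : 0 ≤ ph) (hp : ph ≤ p)
    (hT2 : T ^ 2 ≤ y * h ^ 2) (hyh : y * h ^ 2 ≤ 1) (hTt : T * t ≤ q * (y * h))
    (hT0 : 0 ≤ T) (bC : cl ≤ C) (bS : S ≤ t * sg) (bD : dl ≤ D) (hs0 : 0 ≤ sg) (hc0 : 0 ≤ cl)
    (main : 0 < ph * (1 - y * h ^ 2) * cl - q * (y * h) * sg + dl) :
    0 < p * (1 - T ^ 2) * C - T * S + D := by
  have f1 : ph * (1 - y * h ^ 2) * cl ≤ p * (1 - T ^ 2) * C := by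
    apply mul_le_mul _ bC hc0
    · exact mul_nonneg (by linarith) (by linarith)
    · exact mul_le_mul hp (by linarith) (by linarith) (by linarith)
  have f2 : T * S ≤ q * (y * h) * sg := by
    calc T * S ≤ T * (t * sg) := mul_le_mul_of_nonneg_left bS hT0
      _ = (T * t) * sg := by ring
      _ ≤ _ := mul_le_mul_of_nonneg_right hTt hs0
  linarith

set_option maxHeartbeats 800000 in
lemma q_assemble {t : ℝ} (ht : 0 < t) (ht1 : t ≤ 2 / Real.pi) :
    0 < Real.pi / 2 * (1 - Real.tanh (Real.pi * t / 2) ^ 2) *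
      (∫ s in (0:ℝ)..1, Real.cos (t * Real.log s) * qW s) -
      Real.tanh (Real.pi * t / 2) *
      (∫ s in (0:ℝ)..1, Real.sin (t * Real.log s) * (Real.log s * qW s)) +
      ∫ s in (0:ℝ)..1, Real.cos (t * Real.log s) * (Real.log s * qW s) := by
  have hp := Real.pi_pos
  have hp1 := Real.pi_gt_d6
  have hp2 := Real.pi_lt_d6
  have hC := q_C_ge t
  have hS := q_S_le t ht.le
  have hD := q_D_ge t
  set C := ∫ s in (0:ℝ)..1, Real.cos (t * Real.log s) * qW s
  set S := ∫ s in (0:ℝ)..1, Real.sin (t * Real.log s) * (Real.log s * qW s)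
  set D := ∫ s in (0:ℝ)..1, Real.cos (t * Real.log s) * (Real.log s * qW s)
  set x := Real.pi * t / 2 with hx
  have hx0 : 0 < x := by positivity
  have hx1 : x ≤ 1 := by
    rw [le_div_iff₀ hp] at ht1; rw [hx]; linarith
  have hT := q_tanh_le hx0.le
  have hT0 : 0 ≤ Real.tanh x := by
    rw [Real.tanh_eq_sinh_div_cosh]
    exact div_nonneg (Real.sinh_nonneg_iff.2 hx0.le) (Real.cosh_pos x).le
  set T := Real.tanh x
  set y := x ^ 2 with hy
  have hy0 : 0 ≤ y := by positivity
  have hy1 : y ≤ 1 := pow_le_one₀ hx0.le hx1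
  have htx : t = 2 / Real.pi * x := by rw [hx]; field_simp
  have hq1 : 2 / Real.pi ≤ 63663 / 100000 := by
    rw [div_le_iff₀ hp]; linarith
  have hq2 : 63661 / 100000 ≤ 2 / Real.pi := by
    rw [le_div_iff₀ hp]; linarith
  have hz : t ^ 2 = (2 / Real.pi) ^ 2 * y := by rw [htx]; ring
  have hz1 : 1013 / 2500 * y ≤ t ^ 2 := by
    rw [hz]; apply mul_le_mul_of_nonneg_right _ hy0; nlinarith
  have hz2 : t ^ 2 ≤ 2027 / 5000 * y := by
    rw [hz]; apply mul_le_mul_of_nonneg_right _ hy0; nlinarith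
  have bC := (q_C_low hy0 hz1 hz2).trans hC
  have bS : S ≤ t * (2 / (1 + 1013 / 2500 * y) ^ 2 + 427 / 2304 -
      1351 / 25000 * (1013 / 2500 * y)) := by
    refine hS.trans (le_trans (le_of_eq ?_)
      (mul_le_mul_of_nonneg_left (q_S_up hy0 hy1 hz1 hz2) ht.le))
    ring
  have bD := (q_D_low hy0 hy1 hz1 hz2
    (show 6931 / 10000 ≤ Real.log 2 by linarith [Real.log_two_gt_d9])).trans hD
  have main := q_final_poly hy0 hy1
  have hh0 : 0 ≤ (15 + y) / (15 + 6 * y) := by positivity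
  have hh1 : (15 + y) / (15 + 6 * y) ≤ 1 := by
    rw [div_le_one (by positivity)]; linarith
  set h := (15 + y) / (15 + 6 * y)
  have hs0 : 0 ≤ 2 / (1 + 1013 / 2500 * y) ^ 2 + 427 / 2304 -
      1351 / 25000 * (1013 / 2500 * y) := by
    have : 0 ≤ 2 / (1 + 1013 / 2500 * y) ^ 2 := by positivity
    linarith
  have hc0 : 0 ≤ 2 - 2027 / 5000 * y / (1 + 1013 / 2500 * y) - 427 / 4608 * (2027 / 5000 * y) := by
    have : 2027 / 5000 * y / (1 + 1013 / 2500 * y) ≤ 1 := by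
      rw [div_le_one (by positivity)]; linarith
    linarith
  have hT2 : T ^ 2 ≤ y * h ^ 2 := by
    calc T ^ 2 ≤ (x * h) ^ 2 := pow_le_pow_left₀ hT0 hT 2
      _ = y * h ^ 2 := by rw [hy]; ring
  have hyh : y * h ^ 2 ≤ 1 := by
    have : h ^ 2 ≤ 1 := pow_le_one₀ hh0 hh1
    exact mul_le_one₀ hy1 (sq_nonneg h) this
  have hTt : T * t ≤ 63663 / 100000 * (y * h) := by
    calc T * t ≤ (x * h) * t := mul_le_mul_of_nonneg_right hT ht.le
      _ = 2 / Real.pi * (y * h) := by rw [htx, hy]; ring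
      _ ≤ _ := mul_le_mul_of_nonneg_right hq1 (by positivity)
  exact q_combine (by norm_num) (by linarith) hT2 hyh hTt hT0 bC bS bD hs0 hc0 main

lemma q_by_parts (t : ℝ) :
    (3 * (∫ s in (0:ℝ)..1, Real.cos (t * Real.log s) * Real.sqrt (1 - s)) -
    2 * t * (∫ s in (0:ℝ)..1, Real.sin (t * Real.log s) * Real.sqrt (1 - s)) =
    ∫ s in (0:ℝ)..1, Real.cos (t * Real.log s) * qW s) ∧
    (3 * (∫ s in (0:ℝ)..1, Real.sin (t * Real.log s) * Real.sqrt (1 - s)) +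
    2 * t * (∫ s in (0:ℝ)..1, Real.cos (t * Real.log s) * Real.sqrt (1 - s)) =
    ∫ s in (0:ℝ)..1, Real.sin (t * Real.log s) * qW s) := by
  have iq : IntervalIntegrable (fun s : ℝ => √(1 - s)) volume 0 1 :=
    (by fun_prop : Continuous (fun s : ℝ => √(1 - s))).intervalIntegrable _ _
  have c1 := q_ii_cos t iq
  have c2 := q_ii_cos t q_W_aux.1
  have s1 := q_ii_sin t iq
  have s2 := q_ii_sin t q_W_aux.1
  have hw : ∀ s ∈ Ioo (0:ℝ) 1, s * qW s = qW s - √(1 - s) := by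
    intro s hs
    have hx0 : 0 < √(1 - s) := Real.sqrt_pos.2 (by linarith [hs.2])
    have hxx : √(1 - s) ^ 2 = 1 - s := Real.sq_sqrt (by linarith [hs.2])
    unfold qW
    field_simp
    linarith
  have gen : ∀ α β : ℝ, ∫ s in (0:ℝ)..1,
      ((3 / 2 * α + t * β) * (Real.cos (t * Real.log s) * √(1 - s)) +
      (3 / 2 * β - t * α) * (Real.sin (t * Real.log s) * √(1 - s)) -
      (α / 2 * (Real.cos (t * Real.log s) * qW s) +
      β / 2 * (Real.sin (t * Real.log s) * qW s))) = 0 := by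
    intro α β
    have hc : Continuous (fun s : ℝ => (s * √(1 - s)) *
        (α * Real.cos (t * Real.log s) + β * Real.sin (t * Real.log s))) :=
      q_cont_aux (fun s => s * √(1 - s))
        (fun u => α * Real.cos (t * u) + β * Real.sin (t * u)) _ (by fun_prop) (by simp)
        (by fun_prop) (q_bdd t α β)
    rw [intervalIntegral.integral_eq_sub_of_hasDerivAt_of_le zero_le_one hc.continuousOn]
    · simp
    · intro s hs
      refine (((hasDerivAt_id s).mul (q_d_sqrt hs.2)).mul (((q_d_cos t hs.1).const_mul α).add
        ((q_d_sin t hs.1).const_mul β))).congr_deriv ?_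
      have h := hw s hs
      have hs0 := hs.1.ne'
      simp only [Pi.mul_apply, Pi.add_apply, id]
      have h' : s * (-qW s / 2) = -(qW s - √(1 - s)) / 2 := by rw [← h]; ring
      rw [h']
      field_simp
      ring
    · exact ((c1.const_mul _).add (s1.const_mul _)).sub ((c2.const_mul _).add (s2.const_mul _))
  have gen' := fun α β : ℝ => gen α β
  simp only [fun α β : ℝ => intervalIntegral.integral_sub
    ((c1.const_mul (3 / 2 * α + t * β)).add (s1.const_mul (3 / 2 * β - t * α)))
    ((c2.const_mul (α / 2)).add (s2.const_mul (β / 2))),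
    fun α β : ℝ => intervalIntegral.integral_add
    (c1.const_mul (3 / 2 * α + t * β)) (s1.const_mul (3 / 2 * β - t * α)),
    fun α β : ℝ => intervalIntegral.integral_add
    (c2.const_mul (α / 2)) (s2.const_mul (β / 2)), intervalIntegral.integral_const_mul] at gen'
  have g1 := gen' 1 0
  have g2 := gen' 0 1
  constructor
  · linarith
  · linarith

lemma q_Q_eq (t : ℝ) : Q t = Real.tanh (Real.pi * t / 2) *
    (∫ s in (0:ℝ)..1, Real.cos (t * Real.log s) * qW s) +
    ∫ s in (0:ℝ)..1, Real.sin (t * Real.log s) * qW s := by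
  obtain ⟨h1, h2⟩ := q_by_parts t
  rw [← h1, ← h2]
  unfold Q
  ring

lemma q_W_meas : Measurable qW := by unfold qW; fun_prop

lemma q_deriv_C (t : ℝ) : HasDerivAt
    (fun t => ∫ s in (0:ℝ)..1, Real.cos (t * Real.log s) * qW s)
    (-∫ s in (0:ℝ)..1, Real.sin (t * Real.log s) * (Real.log s * qW s)) t := by
  have hm := q_W_meas
  have := (intervalIntegral.hasDerivAt_integral_of_dominated_loc_of_deriv_le
    (μ := volume) (a := 0) (b := 1)
    (F := fun t s => Real.cos (t * Real.log s) * qW s)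
    (F' := fun t s => -(Real.sin (t * Real.log s) * (Real.log s * qW s)))
    (bound := fun s => |Real.log s * qW s|) (x₀ := t) (s := univ) univ_mem
    (Eventually.of_forall fun t => (by fun_prop : Measurable _).aestronglyMeasurable)
    (q_ii_cos t q_W_aux.1) (by fun_prop : Measurable _).aestronglyMeasurable
    (Eventually.of_forall fun s _ t _ => by
      rw [Real.norm_eq_abs, abs_neg, abs_mul]
      exact mul_le_of_le_one_left (abs_nonneg _) (Real.abs_sin_le_one _))
    q_LW_aux.1.abs
    (Eventually.of_forall fun s _ t _ => by
      refine ((((hasDerivAt_id t).mul_const (Real.log s)).cos).mul_const (qW s)).congr_deriv ?_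
      simp; ring)).2
  rwa [intervalIntegral.integral_neg] at this

lemma q_deriv_S (t : ℝ) : HasDerivAt
    (fun t => ∫ s in (0:ℝ)..1, Real.sin (t * Real.log s) * qW s)
    (∫ s in (0:ℝ)..1, Real.cos (t * Real.log s) * (Real.log s * qW s)) t := by
  have hm := q_W_meas
  exact (intervalIntegral.hasDerivAt_integral_of_dominated_loc_of_deriv_le
    (μ := volume) (a := 0) (b := 1)
    (F := fun t s => Real.sin (t * Real.log s) * qW s)
    (F' := fun t s => (Real.cos (t * Real.log s) * (Real.log s * qW s)))
    (bound := fun s => |Real.log s * qW s|) (x₀ := t) (s := univ) univ_mem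
    (Eventually.of_forall fun t => (by fun_prop : Measurable _).aestronglyMeasurable)
    (q_ii_sin t q_W_aux.1) (by fun_prop : Measurable _).aestronglyMeasurable
    (Eventually.of_forall fun s _ t _ => by
      rw [Real.norm_eq_abs, abs_mul]
      exact mul_le_of_le_one_left (abs_nonneg _) (Real.abs_cos_le_one _))
    q_LW_aux.1.abs
    (Eventually.of_forall fun s _ t _ => by
      refine ((((hasDerivAt_id t).mul_const (Real.log s)).sin).mul_const (qW s)).congr_deriv ?_
      simp; ring)).2

lemma q_deriv_tanh (t : ℝ) : HasDerivAt (fun t => Real.tanh (Real.pi * t / 2))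
    (Real.pi / 2 * (1 - Real.tanh (Real.pi * t / 2) ^ 2)) t := by
  have h : HasDerivAt (fun t => Real.pi * t / 2) (Real.pi / 2) t := by
    simpa using ((hasDerivAt_id t).const_mul Real.pi).div_const 2
  have e : (fun t => Real.tanh (Real.pi * t / 2)) =
      (fun t => Real.sinh (Real.pi * t / 2) / Real.cosh (Real.pi * t / 2)) := by
    funext t; rw [Real.tanh_eq_sinh_div_cosh]
  have hc : Real.cosh (Real.pi * t / 2) ≠ 0 := (Real.cosh_pos _).ne'
  rw [e, Real.tanh_eq_sinh_div_cosh]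
  refine (h.sinh.div h.cosh hc).congr_deriv ?_
  field_simp

lemma q_deriv_Q (t : ℝ) : HasDerivAt Q (Real.pi / 2 * (1 - Real.tanh (Real.pi * t / 2) ^ 2) *
      (∫ s in (0:ℝ)..1, Real.cos (t * Real.log s) * qW s) -
      Real.tanh (Real.pi * t / 2) *
      (∫ s in (0:ℝ)..1, Real.sin (t * Real.log s) * (Real.log s * qW s)) +
      ∫ s in (0:ℝ)..1, Real.cos (t * Real.log s) * (Real.log s * qW s)) t := by
  rw [funext q_Q_eq]
  refine (((q_deriv_tanh t).mul (q_deriv_C t)).add (q_deriv_S t)).congr_deriv ?_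
  ring

/-- `Q` is strictly increasing on `(0, 2/π]`. -/
theorem Q_strictMonoOn : StrictMonoOn Q (Set.Ioc 0 (2 / Real.pi)) := by
  refine strictMonoOn_of_deriv_pos (convex_Ioc _ _)
    (fun t _ => (q_deriv_Q t).continuousAt.continuousWithinAt) (fun t ht => ?_)
  have ht' := interior_subset ht
  rw [(q_deriv_Q t).deriv]
  exact q_assemble ht'.1 ht'.2
end

section
/- For every real number t > 0, Re(Γ(it)/Γ(3/2 + it))·cosh(πt/2) − Im(Γ(it)/Γ(3/2 + it))·sinh(πt/2) > 0. -/
open Complex Filter Topology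

noncomputable def gqC : ℕ → ℝ
  | 0 => 1
  | n + 1 => gqC n * ((n - 1 / 4) / (n + 1))

noncomputable def gqE : ℕ → ℝ
  | 0 => 3 / 16
  | n + 1 => gqE n * ((n + 3 / 4) * (n + 7 / 4) / ((n + 2) * (n + 1)))

noncomputable def gqS (z : ℂ) : ℕ → ℂ
  | 0 => 1
  | n + 1 => gqS z n * ((3 / 4 + n) / (1 + z + n))

noncomputable def gqR (z : ℂ) : ℕ → ℂ
  | 0 => 1
  | n + 1 => gqR z n * ((n + 1) / (1 + z + n))

lemma gqE_pos (n : ℕ) : 0 < gqE n := by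
  induction n with
  | zero => norm_num [gqE]
  | succ n ih => rw [gqE]; positivity

lemma gqE_lt (n : ℕ) : gqE (n + 1) < gqE n := by
  have h := gqE_pos n
  have hn : (0 : ℝ) ≤ n := Nat.cast_nonneg n
  rw [gqE]
  apply mul_lt_of_lt_one_right h
  rw [div_lt_one (by positivity)]
  nlinarith

lemma gqC_neg (n : ℕ) : gqC (n + 1) < 0 := by
  induction n with
  | zero => norm_num [gqC]
  | succ n ih =>
    rw [gqC]
    apply mul_neg_of_neg_of_pos ih
    push_cast
    have hn : (0 : ℝ) ≤ n := Nat.cast_nonneg n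
    apply div_pos <;> linarith

lemma gq_den_ne (y : ℝ) (n : ℕ) : (1 + I * y + n : ℂ) ≠ 0 := by
  intro h
  have := congrArg re h
  simp at this
  have hn : (0 : ℝ) ≤ n := Nat.cast_nonneg n
  linarith

lemma gq_term (y : ℝ) (n : ℕ) :
    (gqC (n + 1) : ℂ) * gqS (I * y) (n + 1) = -(gqE n * (gqR (I * y) n / (1 + I * y + n))) := by
  induction n with
  | zero => simp [gqC, gqS, gqE, gqR]; ring
  | succ n ih =>
    have h1 := gq_den_ne y n
    have h2 := gq_den_ne y (n + 1)
    have h3 : (n + 1 : ℂ) ≠ 0 := by exact_mod_cast Nat.succ_ne_zero n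
    have h4 : (n + 2 : ℂ) ≠ 0 := by exact_mod_cast Nat.succ_ne_zero (n + 1)
    have h5 : (n + 1 + 1 : ℂ) ≠ 0 := by exact_mod_cast Nat.succ_ne_zero (n + 1)
    rw [gqC, gqS, gqE, gqR]
    push_cast at h2 ⊢
    calc _ = ((gqC (n + 1) : ℂ) * gqS (I * y) (n + 1)) *
        (((n + 1 - 1 / 4) / (n + 1 + 1)) * ((3 / 4 + (n + 1)) / (1 + I * y + (n + 1)))) := by ring
      _ = _ := by
        rw [ih]
        field_simp
        ring

lemma gq_im (y : ℝ) (hy : 0 < y) (n : ℕ) :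
    ((gqC (n + 1) : ℂ) * gqS (I * y) (n + 1)).im =
      gqE n * ((1 - (gqR (I * y) (n + 1)).re) - (1 - (gqR (I * y) n).re)) / y := by
  have h1 := gq_den_ne y n
  have hy' : (y : ℂ) ≠ 0 := by exact_mod_cast hy.ne'
  have : gqR (I * y) n / (1 + I * y + n) =
      ((y⁻¹ : ℝ) : ℂ) * (-I * (gqR (I * y) n - gqR (I * y) (n + 1))) := by
    rw [gqR]
    push_cast
    field_simp
    ring_nf
    simp
  rw [gq_term, this, ← mul_assoc, ← ofReal_mul, neg_im, im_ofReal_mul]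
  simp
  field_simp
  ring

lemma gqR_norm (y : ℝ) (n : ℕ) : ‖gqR (I * y) n‖ ≤ 1 := by
  induction n with
  | zero => simp [gqR]
  | succ n ih =>
    rw [gqR, norm_mul]
    apply mul_le_one₀ ih (norm_nonneg _)
    rw [norm_div]
    apply div_le_one_of_le₀ _ (norm_nonneg _)
    have h : ‖(n + 1 : ℂ)‖ = n + 1 := by
      have := Complex.norm_natCast (n + 1)
      push_cast at this
      exact this
    rw [h]
    have := Complex.re_le_norm (1 + I * y + n)
    simp at this
    linarith

lemma gq_abel (y : ℝ) (N : ℕ) :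
    (gqE 0 - gqE 1) * (1 - (gqR (I * y) 1).re) + gqE (N + 1) * (1 - (gqR (I * y) (N + 1)).re) ≤
    ∑ n ∈ Finset.range (N + 1),
      gqE n * ((1 - (gqR (I * y) (n + 1)).re) - (1 - (gqR (I * y) n).re)) := by
  induction N with
  | zero => simp [gqR]; apply le_of_eq; ring
  | succ N ih =>
    rw [Finset.sum_range_succ]
    have h1 := (Complex.re_le_norm _).trans (gqR_norm y (N + 1 + 1))
    have h2 := gqE_lt (N + 1)
    nlinarith

lemma gq_partial (y : ℝ) (hy : 0 < y) (N : ℕ) :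
    (gqE 0 - gqE 1) * (1 - (gqR (I * y) 1).re) / y ≤
      (∑ n ∈ Finset.range (N + 2), (gqC n : ℂ) * gqS (I * y) n).im := by
  rw [Finset.sum_range_succ', add_im, im_sum]
  simp_rw [gq_im y hy]
  rw [← Finset.sum_div]
  have : ((gqC 0 : ℂ) * gqS (I * y) 0).im = 0 := by simp [gqC, gqS]
  rw [this, add_zero]
  gcongr
  have := gq_abel y N
  have h1 := (Complex.re_le_norm _).trans (gqR_norm y (N + 1))
  have h2 := gqE_pos (N + 1)
  nlinarith

lemma gq_delta (y : ℝ) (hy : 0 < y) :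
    0 < (gqE 0 - gqE 1) * (1 - (gqR (I * y) 1).re) / y := by
  have h := gqE_lt 0
  apply div_pos _ hy
  apply mul_pos (by simpa using h)
  simp [gqR, normSq_apply]
  apply inv_lt_one_of_one_lt₀
  nlinarith

lemma gqC_choose (n : ℕ) : Ring.choose (-(1 / 4 : ℝ) + n - 1) n = gqC n := by
  have h : ∀ n : ℕ, (n.factorial : ℝ) * gqC n = (ascPochhammer ℝ n).eval (-(1 / 4 : ℝ)) := by
    intro n
    induction n with
    | zero => simp [gqC]
    | succ n ih =>
      rw [ascPochhammer_succ_eval, ← ih, gqC, Nat.factorial_succ]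
      have h3 : (n + 1 : ℝ) ≠ 0 := by positivity
      push_cast
      field_simp
      ring
  have h1 : Ring.choose (-(1 / 4 : ℝ) + n - 1) n = Ring.multichoose (-(1 / 4 : ℝ)) n := by
    rw [Ring.choose]; congr 1; ring
  have h2 := Ring.factorial_nsmul_multichoose_eq_ascPochhammer (-(1 / 4 : ℝ)) n
  rw [h1]
  have h4 : (n.factorial : ℝ) ≠ 0 := by positivity
  apply mul_left_cancel₀ h4
  rw [h, ← nsmul_eq_mul, h2, Polynomial.ascPochhammer_smeval_eq_eval]

lemma gq_binom (x : ℝ) (h0 : 0 ≤ x) (h1 : x < 1) :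
    HasSum (fun n => gqC n * x ^ n) ((1 - x) ^ (1 / 4 : ℝ)) := by
  have hx : x ∈ Metric.eball (0 : ℝ) 1 := by
    rw [Metric.mem_eball, edist_dist, dist_zero_right, Real.norm_of_nonneg h0]
    rw [← ENNReal.ofReal_one]
    exact (ENNReal.ofReal_lt_ofReal_iff one_pos).2 h1
  have h := (Real.one_div_one_sub_rpow_hasFPowerSeriesOnBall_zero (-(1/4))).hasSum hx
  simp only [FormalMultilinearSeries.ofScalars_apply_eq, gqC_choose] at h
  simp only [zero_add, smul_eq_mul] at h
  have e : (1 - x) ^ (1 / 4 : ℝ) = 1 / (1 - x) ^ (-(1 / 4) : ℝ) := by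
    rw [Real.rpow_neg (by linarith)]
    simp
  rw [e]
  exact h

lemma gq_partial_bound (x : ℝ) (h0 : 0 ≤ x) (h1 : x < 1) (N : ℕ) :
    |∑ n ∈ Finset.range (N + 1), gqC n * x ^ n| ≤ 1 := by
  have h := gq_binom x h0 h1
  have hanti : Antitone (fun N => ∑ n ∈ Finset.range (N + 1), gqC n * x ^ n) := by
    apply antitone_nat_of_succ_le
    intro N
    rw [Finset.sum_range_succ _ (N + 1)]
    have := mul_nonpos_of_nonpos_of_nonneg (gqC_neg N).le (pow_nonneg h0 (N + 1))
    linarith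
  have hl := (tendsto_add_atTop_iff_nat 1).2 h.tendsto_sum_nat
  have h2 := hanti.le_of_tendsto hl N
  have h3 := hanti (Nat.zero_le N)
  simp [gqC] at h3
  have h4 : 0 ≤ (1 - x) ^ (1 / 4 : ℝ) := Real.rpow_nonneg (by linarith) _
  rw [abs_le]
  constructor <;> linarith

lemma gq_beta_succ (y : ℝ) (n : ℕ) :
    betaIntegral (3 / 4 + n) (1 / 4 + I * y) =
      betaIntegral (3 / 4) (1 / 4 + I * y) * gqS (I * y) n := by
  induction n with
  | zero => simp [gqS]
  | succ n ih =>
    have hn : (0 : ℝ) ≤ n := Nat.cast_nonneg n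
    have hre : 0 < (3 / 4 + n : ℂ).re := by simp; positivity
    have hre' : 0 < (3 / 4 + (n + 1 : ℕ) : ℂ).re := by simp; positivity
    have hv : 0 < (1 / 4 + I * y : ℂ).re := by simp
    have h1 := Gamma_mul_Gamma_eq_betaIntegral hre hv
    have h2 := Gamma_mul_Gamma_eq_betaIntegral hre' hv
    have hd := gq_den_ne y n
    have e1 : (3 / 4 + n + (1 / 4 + I * y) : ℂ) = 1 + I * y + n := by ring
    have e2 : (3 / 4 + (n + 1 : ℕ) + (1 / 4 + I * y) : ℂ) = 1 + I * y + n + 1 := by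
      push_cast; ring
    have e3 : (3 / 4 + (n + 1 : ℕ) : ℂ) = 3 / 4 + n + 1 := by push_cast; ring
    have hne : (3 / 4 + n : ℂ) ≠ 0 := by
      intro h; rw [h] at hre; simp at hre
    have hG : Gamma (1 + I * y + n) ≠ 0 := by
      apply Gamma_ne_zero_of_re_pos
      simp; positivity
    rw [e2, e3, Gamma_add_one _ hd, Gamma_add_one _ hne] at h2
    rw [e1] at h1
    rw [gqS, ← mul_assoc, ← ih, e3]
    have : Gamma (1 + I * y + n) * ((3 / 4 + n) * betaIntegral (3 / 4 + n) (1 / 4 + I * y)) =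
        Gamma (1 + I * y + n) * ((1 + I * y + n) *
          betaIntegral (3 / 4 + n + 1) (1 / 4 + I * y)) := by
      linear_combination h2 - (3 / 4 + n) * h1
    have := mul_left_cancel₀ hG this
    rw [← mul_div_assoc, eq_div_iff hd]
    linear_combination -this

lemma gq_gauss (y : ℝ) :
    Tendsto (fun N : ℕ => betaIntegral (3 / 4) (1 / 4 + I * y) *
        ∑ n ∈ Finset.range (N + 1), (gqC n : ℂ) * gqS (I * y) n) atTop
      (𝓝 (betaIntegral (3 / 4) (1 / 2 + I * y))) := by
  have hv : 0 < (1 / 4 + I * y : ℂ).re := by simp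
  have hb : ∀ n : ℕ, IntervalIntegrable (fun x : ℝ =>
      (x : ℂ) ^ (3 / 4 + (n : ℂ) - 1) * (1 - (x : ℂ)) ^ (1 / 4 + I * y - 1 : ℂ))
      MeasureTheory.volume 0 1 := by
    intro n
    exact betaIntegral_convergent (by simp; positivity) hv
  have key : ∀ N : ℕ, betaIntegral (3 / 4) (1 / 4 + I * y) *
        ∑ n ∈ Finset.range (N + 1), (gqC n : ℂ) * gqS (I * y) n =
      ∫ x in (0 : ℝ)..1, ∑ n ∈ Finset.range (N + 1), (gqC n : ℂ) *
        ((x : ℂ) ^ (3 / 4 + (n : ℂ) - 1) * (1 - (x : ℂ)) ^ (1 / 4 + I * y - 1 : ℂ)) := by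
    intro N
    rw [intervalIntegral.integral_finsetSum]
    · rw [Finset.mul_sum]
      apply Finset.sum_congr rfl
      intro n _
      rw [intervalIntegral.integral_const_mul]
      have := gq_beta_succ y n
      rw [betaIntegral] at this
      rw [this]
      ring
    · intro n _
      exact (hb n).const_mul _
  simp_rw [key]
  rw [betaIntegral]
  have hae : ∀ᵐ x : ℝ, x ≠ 1 := by
    simp [MeasureTheory.ae_iff]
  have hpt : ∀ x : ℝ, 0 < x → x < 1 → ∀ N : ℕ,
      (∑ n ∈ Finset.range (N + 1), (gqC n : ℂ) *
        ((x : ℂ) ^ (3 / 4 + (n : ℂ) - 1) * (1 - (x : ℂ)) ^ (1 / 4 + I * y - 1 : ℂ))) =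
      ((∑ n ∈ Finset.range (N + 1), gqC n * x ^ n : ℝ) : ℂ) *
        ((x : ℂ) ^ (3 / 4 - 1 : ℂ) * (1 - (x : ℂ)) ^ (1 / 4 + I * y - 1 : ℂ)) := by
    intro x h0 h1 N
    push_cast
    rw [Finset.sum_mul]
    apply Finset.sum_congr rfl
    intro n _
    have hx : (x : ℂ) ≠ 0 := by exact_mod_cast h0.ne'
    have : (3 / 4 + (n : ℂ) - 1) = (3 / 4 - 1) + n := by ring
    rw [this, cpow_add _ _ hx, cpow_natCast]
    ring
  refine intervalIntegral.tendsto_integral_filter_of_dominated_convergence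
    (fun x : ℝ => ‖(x : ℂ) ^ (3 / 4 - 1 : ℂ) * (1 - (x : ℂ)) ^ (1 / 4 + I * y - 1 : ℂ)‖)
    ?_ ?_ ?_ ?_
  · refine Eventually.of_forall fun N => ?_
    have : IntervalIntegrable (fun x : ℝ => ∑ n ∈ Finset.range (N + 1), (gqC n : ℂ) *
        ((x : ℂ) ^ (3 / 4 + (n : ℂ) - 1) * (1 - (x : ℂ)) ^ (1 / 4 + I * y - 1 : ℂ)))
        MeasureTheory.volume 0 1 := by
      have := IntervalIntegrable.sum (Finset.range (N + 1))
        (f := fun (n : ℕ) (x : ℝ) => (gqC n : ℂ) *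
        ((x : ℂ) ^ (3 / 4 + (n : ℂ) - 1) * (1 - (x : ℂ)) ^ (1 / 4 + I * y - 1 : ℂ)))
        (fun n _ => (hb n).const_mul (gqC n : ℂ))
      have e : (fun x : ℝ => ∑ n ∈ Finset.range (N + 1), (gqC n : ℂ) *
          ((x : ℂ) ^ (3 / 4 + (n : ℂ) - 1) * (1 - (x : ℂ)) ^ (1 / 4 + I * y - 1 : ℂ))) =
          ∑ n ∈ Finset.range (N + 1), (fun (x : ℝ) => (gqC n : ℂ) *
          ((x : ℂ) ^ (3 / 4 + (n : ℂ) - 1) * (1 - (x : ℂ)) ^ (1 / 4 + I * y - 1 : ℂ))) := by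
        ext x
        simp
      rw [e]
      exact this
    rw [intervalIntegrable_iff] at this
    exact this.aestronglyMeasurable
  · refine Eventually.of_forall fun N => ?_
    filter_upwards [hae] with x hx1 hx
    rw [Set.uIoc_of_le zero_le_one] at hx
    have hx2 : x < 1 := lt_of_le_of_ne hx.2 hx1
    rw [hpt x hx.1 hx2 N, norm_mul]
    apply mul_le_of_le_one_left (norm_nonneg _)
    rw [norm_real]
    exact gq_partial_bound x hx.1.le hx2 N
  · have := (hb 0).norm
    simpa using this
  · filter_upwards [hae] with x hx1 hx
    rw [Set.uIoc_of_le zero_le_one] at hx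
    have hx2 : x < 1 := lt_of_le_of_ne hx.2 hx1
    simp_rw [hpt x hx.1 hx2]
    have hl := (tendsto_add_atTop_iff_nat 1).2 (gq_binom x hx.1.le hx2).tendsto_sum_nat
    have hl' := (Complex.continuous_ofReal.tendsto _).comp hl
    have h3 := hl'.mul_const
      ((x : ℂ) ^ (3 / 4 - 1 : ℂ) * (1 - (x : ℂ)) ^ (1 / 4 + I * y - 1 : ℂ))
    have hne : (1 - x : ℂ) ≠ 0 := by
      have : (1 - x) ≠ 0 := by linarith
      exact_mod_cast this
    have e : (x : ℂ) ^ (3 / 4 - 1 : ℂ) * (1 - (x : ℂ)) ^ (1 / 2 + I * y - 1 : ℂ) =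
        (((1 - x) ^ (1 / 4 : ℝ) : ℝ) : ℂ) *
        ((x : ℂ) ^ (3 / 4 - 1 : ℂ) * (1 - (x : ℂ)) ^ (1 / 4 + I * y - 1 : ℂ)) := by
      rw [ofReal_cpow (by linarith)]
      push_cast
      have : (1 / 2 + I * y - 1 : ℂ) = 1 / 4 + (1 / 4 + I * y - 1) := by ring
      rw [this, cpow_add _ _ hne]
      ring
    rw [e]
    exact h3

lemma gq_F (y : ℝ) (hy : 0 < y) :
    0 < (Gamma (1 / 2 + I * y) * Gamma (1 + I * y) /
      (Gamma (5 / 4 + I * y) * Gamma (1 / 4 + I * y))).im := by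
  have h0 : 0 < (3 / 4 : ℂ).re := by norm_num
  have h1 : 0 < (1 / 4 + I * y : ℂ).re := by simp
  have h2 : 0 < (1 / 2 + I * y : ℂ).re := by simp
  have b1 := Gamma_mul_Gamma_eq_betaIntegral h0 h1
  have b2 := Gamma_mul_Gamma_eq_betaIntegral h0 h2
  have e1 : (3 / 4 + (1 / 4 + I * y) : ℂ) = 1 + I * y := by ring
  have e2 : (3 / 4 + (1 / 2 + I * y) : ℂ) = 5 / 4 + I * y := by ring
  rw [e1] at b1
  rw [e2] at b2
  have g0 := Gamma_ne_zero_of_re_pos h0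
  have g1 := Gamma_ne_zero_of_re_pos h1
  have g3 : Gamma (1 + I * y) ≠ 0 := Gamma_ne_zero_of_re_pos (by simp)
  have g4 : Gamma (5 / 4 + I * y) ≠ 0 := Gamma_ne_zero_of_re_pos (by simp)
  have hB : betaIntegral (3 / 4) (1 / 4 + I * y) ≠ 0 := by
    intro h
    rw [h, mul_zero] at b1
    exact mul_ne_zero g0 g1 b1
  have hF : Gamma (1 / 2 + I * y) * Gamma (1 + I * y) /
      (Gamma (5 / 4 + I * y) * Gamma (1 / 4 + I * y)) =
      (betaIntegral (3 / 4) (1 / 4 + I * y))⁻¹ * betaIntegral (3 / 4) (1 / 2 + I * y) := by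
    have c1 : betaIntegral (3 / 4) (1 / 4 + I * y) =
        Gamma (3 / 4) * Gamma (1 / 4 + I * y) / Gamma (1 + I * y) := by
      rw [b1, mul_div_cancel_left₀ _ g3]
    have c2 : betaIntegral (3 / 4) (1 / 2 + I * y) =
        Gamma (3 / 4) * Gamma (1 / 2 + I * y) / Gamma (5 / 4 + I * y) := by
      rw [b2, mul_div_cancel_left₀ _ g4]
    rw [c1, c2]
    field_simp
  have ht := (gq_gauss y).const_mul (betaIntegral (3 / 4) (1 / 4 + I * y))⁻¹
  rw [← hF] at ht
  simp_rw [inv_mul_cancel_left₀ hB] at ht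
  have ht2 := (Complex.continuous_im.tendsto _).comp ((tendsto_add_atTop_iff_nat 1).2 ht)
  exact lt_of_lt_of_le (gq_delta y hy) (ge_of_tendsto' ht2 (gq_partial y hy))

lemma gq_identity (y : ℝ) (hy : 0 < y) :
    ∃ k : ℝ, 0 < k ∧
    Gamma (I * (2 * y)) / Gamma (3 / 2 + I * (2 * y)) *
      (Complex.cosh (Real.pi * y) + I * Complex.sinh (Real.pi * y)) =
    k * (-I * (Gamma (1 / 2 + I * y) * Gamma (1 + I * y) /
      (Gamma (5 / 4 + I * y) * Gamma (1 / 4 + I * y)))) := by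
  have hyc : (y : ℂ) ≠ 0 := by exact_mod_cast hy.ne'
  have hz : (I * y : ℂ) ≠ 0 := mul_ne_zero I_ne_zero hyc
  have g1 : Gamma (1 / 4 + I * y) ≠ 0 := Gamma_ne_zero_of_re_pos (by simp)
  have g4 : Gamma (5 / 4 + I * y) ≠ 0 := Gamma_ne_zero_of_re_pos (by simp)
  have g5 : Gamma (3 / 4 + I * y) ≠ 0 := Gamma_ne_zero_of_re_pos (by simp)
  have g6 : Gamma (3 / 2 + I * (2 * y)) ≠ 0 := Gamma_ne_zero_of_re_pos (by simp)
  have d1 := Gamma_mul_Gamma_add_half (I * y)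
  have d2 := Gamma_mul_Gamma_add_half (3 / 4 + I * y)
  have r := Gamma_mul_Gamma_one_sub (1 / 4 + I * y)
  have f1 : (2 * (I * y) : ℂ) = I * (2 * y) := by ring
  have f2 : (2 * (3 / 4 + I * y) : ℂ) = 3 / 2 + I * (2 * y) := by ring
  have f3 : (3 / 4 + I * y + 1 / 2 : ℂ) = 5 / 4 + I * y := by ring
  have f4 : (I * y + 1 / 2 : ℂ) = 1 / 2 + I * y := by ring
  have f5 : (1 - (1 / 4 + I * y) : ℂ) = (starRingEnd ℂ) (3 / 4 + I * y) := by
    simp [map_ofNat]; ring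
  have f6 : Gamma (1 + I * y) = I * y * Gamma (I * y) := by
    rw [add_comm, Gamma_add_one _ hz]
  have hs : sin (Real.pi * (1 / 4 + I * y)) =
      ((√2 / 2 : ℝ) : ℂ) * (Complex.cosh (Real.pi * y) + I * Complex.sinh (Real.pi * y)) := by
    have : (Real.pi * (1 / 4 + I * y) : ℂ) = ((Real.pi / 4 : ℝ) : ℂ) + (Real.pi * y) * I := by
      push_cast; ring
    rw [this, sin_add, sin_mul_I, cos_mul_I, ← ofReal_sin, ← ofReal_cos, Real.sin_pi_div_four,
      Real.cos_pi_div_four]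
    ring
  rw [f1, f4] at d1
  rw [f2, f3] at d2
  rw [f5, Gamma_conj] at r
  have h2 : (2 : ℂ) ^ (1 - I * (2 * y)) = (2 : ℂ) ^ (1 - (3 / 2 + I * (2 * y))) *
      (((2 : ℝ) ^ (3 / 2 : ℝ) : ℝ) : ℂ) := by
    rw [ofReal_cpow (by norm_num)]
    push_cast
    rw [← cpow_add _ _ two_ne_zero]
    congr 1; ring
  have hp : (2 : ℂ) ^ (1 - (3 / 2 + I * (2 * y))) ≠ 0 := by simp [cpow_eq_zero_iff]
  have hpi : ((√Real.pi : ℝ) : ℂ) ≠ 0 := by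
    have : √Real.pi ≠ 0 := (Real.sqrt_pos.2 Real.pi_pos).ne'
    exact_mod_cast this
  have hpi' : (Real.pi : ℂ) ≠ 0 := by exact_mod_cast Real.pi_pos.ne'
  have hw : ((√2 / 2 : ℝ) : ℂ) ≠ 0 := by
    have : (√2 / 2 : ℝ) ≠ 0 := by positivity
    exact_mod_cast this
  have hc : (((2 : ℝ) ^ (3 / 2 : ℝ) : ℝ) : ℂ) ≠ 0 := by
    have : ((2 : ℝ) ^ (3 / 2 : ℝ)) ≠ 0 := by positivity
    exact_mod_cast this
  have gconj : (starRingEnd ℂ) (Gamma (3 / 4 + I * y)) ≠ 0 := by simpa using g5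
  have hnorm : (((‖Gamma (3 / 4 + I * y)‖ ^ 2 : ℝ)) : ℂ) =
      Gamma (3 / 4 + I * y) * (starRingEnd ℂ) (Gamma (3 / 4 + I * y)) := by
    rw [mul_conj, normSq_eq_norm_sq]
  have hn : 0 < ‖Gamma (3 / 4 + I * y)‖ ^ 2 := by positivity
  refine ⟨Real.pi / ((√2 / 2) * (2 : ℝ) ^ (3 / 2 : ℝ) * y * ‖Gamma (3 / 4 + I * y)‖ ^ 2),
    div_pos Real.pi_pos (by positivity), ?_⟩
  rw [ofReal_div, ofReal_mul, ofReal_mul, ofReal_mul, hnorm, f6]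
  rw [hs] at r
  rw [h2] at d1
  set Q := Complex.cosh (Real.pi * y) + I * Complex.sinh (Real.pi * y) with hQ
  set w : ℂ := ((√2 / 2 : ℝ) : ℂ)
  set c : ℂ := (((2 : ℝ) ^ (3 / 2 : ℝ) : ℝ) : ℂ)
  set p : ℂ := (2 : ℂ) ^ (1 - (3 / 2 + I * (2 * y)))
  set G2 := Gamma (I * (2 * y))
  set H2 := Gamma (3 / 2 + I * (2 * y))
  set A := Gamma (I * y)
  set B := Gamma (1 / 2 + I * y)
  set C := Gamma (3 / 4 + I * y)
  set C' := (starRingEnd ℂ) C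
  set D := Gamma (5 / 4 + I * y)
  set E := Gamma (1 / 4 + I * y)
  have hQ0 : w * Q ≠ 0 := by
    intro h
    rw [h, div_zero] at r
    exact mul_ne_zero g1 gconj r
  have hQ1 : Q = Real.pi / (w * (E * C')) := by
    rw [r]; field_simp [right_ne_zero_of_mul hQ0]
  have hG2 : G2 = A * B / (p * c * (√Real.pi : ℝ)) := by
    rw [d1]; field_simp
  have hH2 : H2 = C * D / (p * (√Real.pi : ℝ)) := by
    rw [d2]; field_simp
  rw [hQ1, hG2, hH2]
  field_simp
  linear_combination (A * B) * I_sq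

/-- For every real `t > 0`,
`Re(Γ(it)/Γ(3/2 + it))·cosh(πt/2) − Im(Γ(it)/Γ(3/2 + it))·sinh(πt/2) > 0`. -/
theorem gamma_quotient_ineq (t : ℝ) (ht : 0 < t) :
    0 < (Complex.Gamma (Complex.I * t) / Complex.Gamma (3 / 2 + Complex.I * t)).re *
          Real.cosh (Real.pi * t / 2) -
        (Complex.Gamma (Complex.I * t) / Complex.Gamma (3 / 2 + Complex.I * t)).im *
          Real.sinh (Real.pi * t / 2) := by
  have hy : 0 < t / 2 := by positivity
  obtain ⟨k, hk, h⟩ := gq_identity (t / 2) hy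
  have hF := gq_F (t / 2) hy
  have e1 : (2 * ((t / 2 : ℝ) : ℂ)) = t := by push_cast; ring
  have e2 : (Real.pi * ((t / 2 : ℝ) : ℂ)) = ((Real.pi * t / 2 : ℝ) : ℂ) := by push_cast; ring
  rw [e1, e2, ← ofReal_cosh, ← ofReal_sinh] at h
  have h' := congrArg re h
  rw [re_ofReal_mul] at h'
  simp only [mul_re, add_re, add_im, mul_im, ofReal_re, ofReal_im, I_re, I_im, neg_re, neg_im]
    at h'
  ring_nf at h' hF ⊢
  nlinarith [mul_pos hk hF]
end
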